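/- arXiv:1404.0890 — 5 statements merged into one kernel-verified Lean document; each statement's English description precedes it below -/
import Mathlib

section
/- Let V be a Banach space, T>0, and let μ be a C¹-approximate flow on V with constants c₁>0 and a>1. Fix ε∈(0,1) and let L be any constant with L > 2c₁/(1−m_ε). Then there exists δ>0 such that for all 0≤s≤t≤T with t−s≤δ and every ε-special partition π_{ts} of [s,t], one has ‖μ_{π_{ts}} − μ_{ts}‖_∞ ≤ L|t−s|^a. -/
/-!
Statement 1: C⁰ estimate on ε-special partitions (lemma 2.4 / LemImprovedEqMumu).
-/

variable {V : Type*} [NormedAddCommGroup V] [NormedSpace ℝ V] [CompleteSpace V]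

/-- The composition `μ_{t_n t_{n-1}} ∘ ⋯ ∘ μ_{t_1 t_0}` along the points `tt 0, …, tt n`. -/
def compAlong (μ : ℝ → ℝ → V → V) (tt : ℕ → ℝ) : ℕ → V → V
  | 0 => id
  | n + 1 => μ (tt (n + 1)) (tt n) ∘ compAlong μ tt n

/-- `tt 0 = s < tt 1 < ⋯ < tt n = t` is a partition of `[s, t]`. -/
def IsPartition (s t : ℝ) (n : ℕ) (tt : ℕ → ℝ) : Prop :=
  tt 0 = s ∧ tt n = t ∧ ∀ i < n, tt i < tt (i + 1)

/-- A `C¹`-approximate flow on `V` over the time interval `[0,T]`, with constants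
`c₁ > 0` and `a > 1`. -/
def IsC1ApproxFlow (T c₁ a : ℝ) (μ : ℝ → ℝ → V → V) : Prop :=
  (∀ s t, 0 ≤ s → s ≤ t → t ≤ T → ContDiff ℝ 2 (μ t s)) ∧
  (∀ s₀ t₀, 0 ≤ s₀ → s₀ ≤ t₀ → t₀ ≤ T → ∀ ε > (0:ℝ), ∃ η > (0:ℝ), ∀ s t,
    0 ≤ s → s ≤ t → t ≤ T → |s - s₀| ≤ η → |t - t₀| ≤ η →
    ∀ x, ‖μ t s x - μ t₀ s₀ x‖ ≤ ε) ∧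
  (∀ ε > (0:ℝ), ∃ η > (0:ℝ), ∀ s t, 0 ≤ s → s ≤ t → t ≤ T → t - s ≤ η → ∀ x,
    ‖μ t s x - x‖ + ‖fderiv ℝ (μ t s) x - ContinuousLinearMap.id ℝ V‖ +
      ‖iteratedFDeriv ℝ 2 (μ t s) x‖ ≤ ε) ∧
  (∀ s u t, 0 ≤ s → s ≤ u → u ≤ t → t ≤ T → ∀ x,
    ‖μ t u (μ u s x) - μ t s x‖ +
      ‖fderiv ℝ (fun y => μ t u (μ u s y)) x - fderiv ℝ (μ t s) x‖ ≤ c₁ * (t - s) ^ a)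

/-- The partition of `[tt i, tt j]` given by the points `tt i, tt (i+1), …, tt j` is
`ε`-special: it is either trivial, or there is a partition point `tt k` with
`ε ≤ (tt k - tt i)/(tt j - tt i) ≤ 1 - ε`, and for any such point the two induced
partitions of `[tt i, tt k]` and `[tt k, tt j]` are again `ε`-special. -/
inductive EpsSpecial (ε : ℝ) (tt : ℕ → ℝ) : ℕ → ℕ → Prop where
  | triv {i j : ℕ} : j ≤ i + 1 → EpsSpecial ε tt i j
  | node {i j : ℕ} :
      i + 1 < j →
      (∃ k, i < k ∧ k < j ∧ ε ≤ (tt k - tt i) / (tt j - tt i) ∧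
        (tt k - tt i) / (tt j - tt i) ≤ 1 - ε) →
      (∀ k, i < k → k < j → ε ≤ (tt k - tt i) / (tt j - tt i) →
        (tt k - tt i) / (tt j - tt i) ≤ 1 - ε → EpsSpecial ε tt i k) →
      (∀ k, i < k → k < j → ε ≤ (tt k - tt i) / (tt j - tt i) →
        (tt k - tt i) / (tt j - tt i) ≤ 1 - ε → EpsSpecial ε tt k j) →
      EpsSpecial ε tt i j

/-- `m_ε = sup_{ε ≤ β ≤ 1-ε} (β^a + (1-β)^a)`. -/
noncomputable def mEps (ε a : ℝ) : ℝ :=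
  sSup ((fun β : ℝ => β ^ a + (1 - β) ^ a) '' Set.Icc ε (1 - ε))

lemma rpow_add_one_sub_rpow_lt_one {a β : ℝ} (ha : 1 < a) (h0 : 0 < β) (h1 : β < 1) :
    β ^ a + (1 - β) ^ a < 1 := by
  have hβ : β ^ a < β := Real.rpow_lt_self_of_lt_one h0 h1 ha
  have hβ' : (1 - β) ^ a < 1 - β := Real.rpow_lt_self_of_lt_one (by linarith) (by linarith) ha
  linarith

lemma continuous_rpow_add_one_sub_rpow {a : ℝ} (ha : 0 ≤ a) :
    Continuous fun β : ℝ => β ^ a + (1 - β) ^ a :=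
  (Real.continuous_rpow_const ha).add
    ((Real.continuous_rpow_const ha).comp (continuous_const.sub continuous_id))

lemma mEps_lt_one {ε a : ℝ} (hε : 0 < ε) (ha : 1 < a) : mEps ε a < 1 := by
  unfold mEps
  rcases (Set.Icc ε (1 - ε)).eq_empty_or_nonempty with h | h
  · simp [h]
  · obtain ⟨β, hβ, heq⟩ := isCompact_Icc.exists_sSup_image_eq h
      (continuous_rpow_add_one_sub_rpow (a := a) (by linarith)).continuousOn
    rw [heq]
    exact rpow_add_one_sub_rpow_lt_one ha (hε.trans_le hβ.1) (by linarith [hβ.2])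

lemma rpow_add_one_sub_rpow_le_mEps {ε a β : ℝ} (ha : 0 ≤ a) (hβ : β ∈ Set.Icc ε (1 - ε)) :
    β ^ a + (1 - β) ^ a ≤ mEps ε a :=
  le_csSup (isCompact_Icc.bddAbove_image (continuous_rpow_add_one_sub_rpow ha).continuousOn)
    (Set.mem_image_of_mem _ hβ)

lemma rpow_sub_add_rpow_sub_le_mEps_mul {ε a s u t : ℝ} (ha : 0 ≤ a) (hsu : s ≤ u) (hut : u ≤ t)
    (hst : s < t) (hβ : (u - s) / (t - s) ∈ Set.Icc ε (1 - ε)) :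
    (u - s) ^ a + (t - u) ^ a ≤ mEps ε a * (t - s) ^ a := by
  have hpos : 0 < t - s := sub_pos.2 hst
  have h := rpow_add_one_sub_rpow_le_mEps ha hβ
  have h1 : 1 - (u - s) / (t - s) = (t - u) / (t - s) := by
    field_simp
    ring
  rw [h1, Real.div_rpow (by linarith) hpos.le, Real.div_rpow (by linarith) hpos.le,
    ← add_div, div_le_iff₀ (Real.rpow_pos_of_pos hpos a)] at h
  exact h

lemma compAlong_add {E : Type*} (μ : ℝ → ℝ → E → E) (tt : ℕ → ℝ) (m n : ℕ) (x : E) :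
    compAlong μ tt (m + n) x =
      compAlong μ (fun l => tt (m + l)) n (compAlong μ tt m x) := by
  induction n with
  | zero => rfl
  | succ n ih =>
    change μ _ _ (compAlong μ tt (m + n) x) = μ _ _ _
    rw [ih]
    rfl

lemma compAlong_sub_eq_comp {E : Type*} (μ : ℝ → ℝ → E → E) (tt : ℕ → ℝ) {i k j : ℕ}
    (hik : i ≤ k) (hkj : k ≤ j) (x : E) :
    compAlong μ (fun l => tt (i + l)) (j - i) x =
      compAlong μ (fun l => tt (k + l)) (j - k)
        (compAlong μ (fun l => tt (i + l)) (k - i) x) := by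
  rw [show j - i = (k - i) + (j - k) by omega, compAlong_add]
  simp only [← add_assoc, Nat.add_sub_cancel' hik]

/-- The `C⁰` estimate along `ε`-special partitions for a family of maps which is close to being a
flow, with the Lipschitz constant `1 + η` of its maps compensated by the size of `L`. -/
lemma norm_compAlong_sub_le_of_epsSpecial {E : Type*} [NormedAddCommGroup E]
    {μ : ℝ → ℝ → E → E} {ε a c η L : ℝ} {tt : ℕ → ℝ} {n : ℕ} (ha : 0 ≤ a)
    (hη : 0 ≤ η) (hL : 0 ≤ L) (hηL : mEps ε a * L + η * L + c ≤ L)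
    (hmono : StrictMonoOn tt (Set.Iic n))
    (hid : ∀ i ≤ n, ∀ x, μ (tt i) (tt i) x = x)
    (hlip : ∀ i j, i ≤ j → j ≤ n → ∀ x y,
      ‖μ (tt j) (tt i) x - μ (tt j) (tt i) y‖ ≤ (1 + η) * ‖x - y‖)
    (hflow : ∀ i k j, i ≤ k → k ≤ j → j ≤ n → ∀ x,
      ‖μ (tt j) (tt k) (μ (tt k) (tt i) x) - μ (tt j) (tt i) x‖ ≤ c * (tt j - tt i) ^ a)
    {i j : ℕ} (h : EpsSpecial ε tt i j) (hij : i ≤ j) (hjn : j ≤ n) (x : E) :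
    ‖compAlong μ (fun l => tt (i + l)) (j - i) x - μ (tt j) (tt i) x‖ ≤
      L * (tt j - tt i) ^ a := by
  induction h generalizing x with
  | @triv i j hji =>
    have hle : tt i ≤ tt j := hmono.monotoneOn (hij.trans hjn) hjn hij
    have hrhs : 0 ≤ L * (tt j - tt i) ^ a :=
      mul_nonneg hL (Real.rpow_nonneg (sub_nonneg.2 hle) a)
    obtain rfl | rfl : j = i ∨ j = i + 1 := by omega
    · simpa [compAlong, hid _ hjn] using hrhs
    · simpa [compAlong] using hrhs
  | @node i j _ hex _ _ ih₁ ih₂ =>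
    obtain ⟨k, hik, hkj, hk₁, hk₂⟩ := hex
    have hkn : k ≤ n := hkj.le.trans hjn
    have hin : i ≤ n := hij.trans hjn
    have hsu : tt i < tt k := hmono hin hkn hik
    have hut : tt k < tt j := hmono hkn hjn hkj
    rw [compAlong_sub_eq_comp μ tt hik.le hkj.le]
    set y := compAlong μ (fun l => tt (i + l)) (k - i) x
    have e₁ : ‖y - μ (tt k) (tt i) x‖ ≤ L * (tt k - tt i) ^ a :=
      ih₁ k hik hkj hk₁ hk₂ hik.le hkn x
    have e₂ := ih₂ k hik hkj hk₁ hk₂ hkj.le hjn y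
    have e₃ := (hlip k j hkj.le hjn y (μ (tt k) (tt i) x)).trans
      (mul_le_mul_of_nonneg_left e₁ (by linarith))
    have e₄ := hflow i k j hik.le hkj.le hjn x
    have hm := mul_le_mul_of_nonneg_left
      (rpow_sub_add_rpow_sub_le_mEps_mul ha hsu.le hut.le (hsu.trans hut) ⟨hk₁, hk₂⟩) hL
    have hη' : η * L * (tt k - tt i) ^ a ≤ η * L * (tt j - tt i) ^ a := by
      have := hsu.le
      gcongr
    have hfin := mul_le_mul_of_nonneg_right hηL
      (Real.rpow_nonneg (by linarith : 0 ≤ tt j - tt i) a)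
    refine (norm_sub_le_norm_sub_add_norm_sub _ (μ (tt j) (tt k) y) _).trans ?_
    have := norm_sub_le_norm_sub_add_norm_sub (μ (tt j) (tt k) y)
      (μ (tt j) (tt k) (μ (tt k) (tt i) x)) (μ (tt j) (tt i) x)
    linarith

lemma norm_sub_le_of_norm_fderiv_sub_id_le {E : Type*} [NormedAddCommGroup E] [NormedSpace ℝ E]
    {f : E → E} {η : ℝ} (hf : Differentiable ℝ f)
    (h : ∀ x, ‖fderiv ℝ f x - ContinuousLinearMap.id ℝ E‖ ≤ η) (x y : E) :
    ‖f x - f y‖ ≤ (1 + η) * ‖x - y‖ := by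
  refine convex_univ.norm_image_sub_le_of_norm_fderiv_le (𝕜 := ℝ) (fun z _ => hf z)
    (fun z _ => ?_) (Set.mem_univ y) (Set.mem_univ x)
  have h₁ := norm_le_norm_add_norm_sub' (fderiv ℝ f z) (ContinuousLinearMap.id ℝ E)
  have h₂ : ‖ContinuousLinearMap.id ℝ E‖ ≤ 1 := ContinuousLinearMap.norm_id_le
  linarith [h z]

lemma IsC1ApproxFlow.apply_self {E : Type*} [NormedAddCommGroup E] [NormedSpace ℝ E]
    {T c₁ a : ℝ} {μ : ℝ → ℝ → E → E} (hμ : IsC1ApproxFlow T c₁ a μ)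
    {t : ℝ} (h0 : 0 ≤ t) (hT : t ≤ T) (x : E) : μ t t x = x := by
  refine sub_eq_zero.1 (norm_le_zero_iff.1 (le_of_forall_pos_le_add fun r hr => ?_))
  obtain ⟨η, hη, h⟩ := hμ.2.2.1 r hr
  have := h t t h0 le_rfl hT (by simpa using hη.le) x
  have h₁ := norm_nonneg (fderiv ℝ (μ t t) x - ContinuousLinearMap.id ℝ E)
  have h₂ := norm_nonneg (iteratedFDeriv ℝ 2 (μ t t) x)
  linarith

/-- C⁰ estimate `‖μ_{π_{ts}} - μ_{ts}‖_∞ ≤ L |t-s|^a` along `ε`-special partitions. -/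
theorem special_partition_C0_estimate
    (T c₁ a : ℝ) (hT : 0 < T) (hc₁ : 0 < c₁) (ha : 1 < a)
    (μ : ℝ → ℝ → V → V) (hμ : IsC1ApproxFlow T c₁ a μ)
    (ε : ℝ) (hε : 0 < ε) (hε1 : ε < 1)
    (L : ℝ) (hL : 2 * c₁ / (1 - mEps ε a) < L) :
    ∃ δ > (0:ℝ), ∀ s t, 0 ≤ s → s ≤ t → t ≤ T → t - s ≤ δ →
      ∀ n (tt : ℕ → ℝ), IsPartition s t n tt → EpsSpecial ε tt 0 n →
      ∀ x, ‖compAlong μ tt n x - μ t s x‖ ≤ L * (t - s) ^ a := by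
  have hm : 0 < 1 - mEps ε a := sub_pos.2 (mEps_lt_one hε ha)
  have hL0 : 0 < L := lt_trans (by positivity) hL
  rw [div_lt_iff₀ hm] at hL
  obtain ⟨δ, hδ, hclose⟩ := hμ.2.2.1 (c₁ / L) (by positivity)
  refine ⟨δ, hδ, fun s t hs _ ht hst n tt hpart hspec x => ?_⟩
  obtain ⟨rfl, rfl, hlt⟩ := hpart
  have hmono : StrictMonoOn tt (Set.Iic n) :=
    strictMonoOn_Iic_of_lt_succ fun i hi => hlt i hi
  have hle : ∀ i j, i ≤ j → j ≤ n → tt i ≤ tt j := fun i j hij hjn =>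
    hmono.monotoneOn (hij.trans hjn) hjn hij
  have h0 : ∀ i ≤ n, 0 ≤ tt i := fun i hi => hs.trans (hle 0 i i.zero_le hi)
  have hT' : ∀ i ≤ n, tt i ≤ T := fun i hi => (hle i n hi le_rfl).trans ht
  have key := norm_compAlong_sub_le_of_epsSpecial (μ := μ) (c := c₁) (η := c₁ / L) (L := L)
    (by linarith : 0 ≤ a) (by positivity) hL0.le
    (by rw [div_mul_cancel₀ _ hL0.ne']; linarith) hmono
    (fun i hi => hμ.apply_self (h0 i hi) (hT' i hi))
    (fun i j hij hjn => norm_sub_le_of_norm_fderiv_sub_id_le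
      ((hμ.1 _ _ (h0 i (hij.trans hjn)) (hle i j hij hjn) (hT' j hjn)).differentiable
        two_ne_zero) fun z => ?_)
    (fun i k j hik hkj hjn z => ?_) hspec n.zero_le le_rfl x
  · simpa using key
  · have := hclose (tt i) (tt j) (h0 i (hij.trans hjn)) (hle i j hij hjn) (hT' j hjn)
      (by linarith [hle 0 i i.zero_le (hij.trans hjn), hle j n hjn le_rfl]) z
    have h₁ := norm_nonneg (μ (tt j) (tt i) z - z)
    have h₂ := norm_nonneg (iteratedFDeriv ℝ 2 (μ (tt j) (tt i)) z)
    linarith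
  · exact (le_add_of_nonneg_right (norm_nonneg _)).trans
      (hμ.2.2.2 (tt i) (tt k) (tt j) (h0 i ((hik.trans hkj).trans hjn))
        (hle i k hik (hkj.trans hjn)) (hle k j hkj hjn) (hT' j hjn) z)
end

section
/- (Sewing lemma of Feyel–de la Pradelle.) Let V be a Banach space and let μ = (μ_{ts})_{0≤s≤t≤1} be a continuous V-valued map on {(s,t) : 0≤s≤t≤1} such that for some constants c₀>0 and a>1 one has |(μ_{tu} + μ_{us}) − μ_{ts}| ≤ c₀|t−s|^a for all 0≤s≤u≤t≤1. Then there exists a unique map φ : [0,1] → V with φ₀ = 0 such that, for some constant c>0, the increments φ_{ts} := φ_t − φ_s satisfy |φ_{ts} − μ_{ts}| ≤ c|t−s|^a for all 0≤s≤t≤1 (unique in the sense that any two such maps with φ₀ = 0 coincide, regardless of the constants c witnessing the estimate). -/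
/-!
# The sewing lemma of Feyel–de la Pradelle

The map `φ` is the limit of the Riemann-type sums of `μ` along the dyadic partitions, truncated at
`t`. The key estimate `norm_sum_Ico_sub_le` bounds the distance between an arbitrary partition sum
and `μ` evaluated on the whole interval.
-/

namespace Sewing

open Finset Filter Topology

lemma two_mul_half_rpow {h a : ℝ} (hh : 0 ≤ h) :
    2 * (h / 2) ^ a = (2 : ℝ) ^ (1 - a) * h ^ a := by
  rw [Real.div_rpow hh zero_le_two, Real.rpow_sub two_pos, Real.rpow_one]
  ring

lemma two_pow_mul_inv_rpow (a : ℝ) (n : ℕ) :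
    (2 : ℝ) ^ n * (1 / 2 ^ n) ^ a = ((2 : ℝ) ^ (1 - a)) ^ n := by
  rw [Real.div_rpow zero_le_one (by positivity), Real.one_rpow, Real.rpow_sub two_pos,
    Real.rpow_one, div_pow, Real.rpow_pow_comm zero_le_two]
  ring

lemma two_rpow_one_sub_lt_one {a : ℝ} (ha : 1 < a) : (2 : ℝ) ^ (1 - a) < 1 :=
  Real.rpow_lt_one_of_one_lt_of_neg one_lt_two (by linarith)

/-- A finite monotone sequence has a step that straddles the midpoint of its range. -/
lemma exists_step_across_midpoint {x : ℕ → ℝ} (hx : Monotone x) {m n : ℕ} (hmn : m < n) :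
    ∃ j, m ≤ j ∧ j < n ∧ x j - x m ≤ (x n - x m) / 2 ∧ x n - x (j + 1) ≤ (x n - x m) / 2 := by
  classical
  have hle : x m ≤ x n := hx hmn.le
  have hex : ∃ k, m < k ∧ (k = n ∨ (x m + x n) / 2 < x k) := ⟨n, hmn, Or.inl rfl⟩
  obtain ⟨j, hj⟩ : ∃ j, Nat.find hex = j + 1 :=
    Nat.exists_eq_succ_of_ne_zero (by have := (Nat.find_spec hex).1; omega)
  have hspec := Nat.find_spec hex
  have hmin : Nat.find hex ≤ n := Nat.find_min' hex ⟨hmn, Or.inl rfl⟩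
  have hnot := Nat.find_min hex (m := j) (by omega)
  rw [hj] at hspec hmin
  refine ⟨j, by omega, by omega, ?_, ?_⟩
  · rcases (Nat.lt_succ_iff.mp hspec.1).eq_or_lt with rfl | hlt
    · linarith
    · have : x j ≤ (x m + x n) / 2 := by
        by_contra! hc
        exact hnot ⟨hlt, Or.inr hc⟩
      linarith
  · rcases hspec.2 with h | h
    · rw [h]
      linarith
    · linarith

variable {V : Type*} [NormedAddCommGroup V] {μ : ℝ → ℝ → V} {c₀ a : ℝ}

/-- Almost-additivity of `μ` on the simplex `0 ≤ s ≤ t ≤ 1`. -/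
def AlmostAdditive (μ : ℝ → ℝ → V) (c₀ a : ℝ) : Prop :=
  ∀ s u t, 0 ≤ s → s ≤ u → u ≤ t → t ≤ 1 → ‖μ t u + μ u s - μ t s‖ ≤ c₀ * (t - s) ^ a

lemma AlmostAdditive.apply_self (hadd : AlmostAdditive μ c₀ a) (ha : 1 < a) {s : ℝ} (hs : 0 ≤ s)
    (hs1 : s ≤ 1) : μ s s = 0 := by
  have h := hadd s s s hs le_rfl le_rfl hs1
  rw [sub_self, Real.zero_rpow (by linarith), mul_zero] at h
  simpa using h

/-- Partition sums of an almost additive map stay close to its value on the whole interval. -/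
lemma AlmostAdditive.norm_sum_Ico_sub_le (hadd : AlmostAdditive μ c₀ a) (hc₀ : 0 < c₀)
    (ha : 1 < a) {x : ℕ → ℝ} (hx : Monotone x) (hx0 : ∀ k, 0 ≤ x k) (hx1 : ∀ k, x k ≤ 1)
    {m n : ℕ} (hmn : m ≤ n) :
    ‖∑ k ∈ Ico m n, μ (x (k + 1)) (x k) - μ (x n) (x m)‖ ≤
      2 * c₀ / (1 - (2 : ℝ) ^ (1 - a)) * (x n - x m) ^ a := by
  have hr := two_rpow_one_sub_lt_one ha
  set K := 2 * c₀ / (1 - (2 : ℝ) ^ (1 - a)) with hK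
  have hKr : K * (1 - (2 : ℝ) ^ (1 - a)) = 2 * c₀ := div_mul_cancel₀ _ (by linarith)
  have hK0 : 0 < K := div_pos (by linarith) (by linarith)
  induction hd : n - m using Nat.strong_induction_on generalizing m n with
  | _ d ih =>
  rcases hmn.eq_or_lt with rfl | hlt
  · rw [Ico_self, sum_empty, hadd.apply_self ha (hx0 _) (hx1 _), sub_self, sub_self, norm_zero,
      Real.zero_rpow (by linarith), mul_zero]
  obtain ⟨j, hmj, hjn, hl, hu⟩ := exists_step_across_midpoint hx hlt
  have hxmj : x m ≤ x j := hx hmj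
  have hxj : x j ≤ x (j + 1) := hx j.le_succ
  have hxjn : x (j + 1) ≤ x n := hx hjn
  have ha0 : 0 ≤ a := by linarith
  have hA := ih (j - m) (by omega) hmj rfl
  have hB := ih (n - (j + 1)) (by omega) (Nat.succ_le_of_lt hjn) rfl
  have hA' : (x j - x m) ^ a ≤ ((x n - x m) / 2) ^ a :=
    Real.rpow_le_rpow (by linarith) hl ha0
  have hB' : (x n - x (j + 1)) ^ a ≤ ((x n - x m) / 2) ^ a :=
    Real.rpow_le_rpow (by linarith) hu ha0
  have hC := hadd (x m) (x j) (x (j + 1)) (hx0 _) hxmj hxj (hx1 _)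
  have hC' : (x (j + 1) - x m) ^ a ≤ (x n - x m) ^ a :=
    Real.rpow_le_rpow (by linarith) (by linarith) ha0
  have hD := hadd (x m) (x (j + 1)) (x n) (hx0 _) (hxmj.trans hxj) hxjn (hx1 _)
  have hhalf := two_mul_half_rpow (a := a) (sub_nonneg.mpr (hx hmn))
  have hsum : ∑ k ∈ Ico m n, μ (x (k + 1)) (x k) - μ (x n) (x m) =
      (∑ k ∈ Ico m j, μ (x (k + 1)) (x k) - μ (x j) (x m)) +
      (∑ k ∈ Ico (j + 1) n, μ (x (k + 1)) (x k) - μ (x n) (x (j + 1))) +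
      (μ (x (j + 1)) (x j) + μ (x j) (x m) - μ (x (j + 1)) (x m)) +
      (μ (x n) (x (j + 1)) + μ (x (j + 1)) (x m) - μ (x n) (x m)) := by
    rw [← sum_Ico_consecutive _ hmj hjn.le, sum_eq_sum_Ico_succ_bot hjn]
    abel
  rw [hsum]
  calc _ ≤ _ := norm_add₄_le
    _ ≤ K * ((x n - x m) / 2) ^ a + K * ((x n - x m) / 2) ^ a + c₀ * (x n - x m) ^ a +
        c₀ * (x n - x m) ^ a := by
      gcongr
      · exact hA.trans (by gcongr)
      · exact hB.trans (by gcongr)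
      · exact hC.trans (by gcongr)
    _ = K * (x n - x m) ^ a := by linear_combination K * hhalf - (x n - x m) ^ a * hKr

/-- The sum of `μ` along the dyadic partition of level `n`, truncated at `t`. -/
noncomputable def dyadicSum (μ : ℝ → ℝ → V) (n : ℕ) (t : ℝ) : V :=
  ∑ k ∈ range (2 ^ n), μ (min t ((k + 1 : ℕ) / 2 ^ n)) (min t ((k : ℕ) / 2 ^ n))

/-- A sum over the cells of level `n` is small if each of its terms is `O((2⁻ⁿ)ᵃ)`. -/
lemma norm_sum_range_two_pow_le {f : ℕ → V} {c : ℝ} {n : ℕ}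
    (hf : ∀ k < 2 ^ n, ‖f k‖ ≤ c * (1 / 2 ^ n) ^ a) :
    ‖∑ k ∈ range (2 ^ n), f k‖ ≤ c * ((2 : ℝ) ^ (1 - a)) ^ n := by
  refine (norm_sum_le_of_le _ fun k hk => hf k (mem_range.mp hk)).trans_eq ?_
  rw [sum_const, card_range, nsmul_eq_mul, ← two_pow_mul_inv_rpow]
  push_cast
  ring

lemma AlmostAdditive.norm_le_of_sub_le (hadd : AlmostAdditive μ c₀ a) (hc₀ : 0 < c₀)
    (ha : 1 < a) {s u t δ : ℝ} (hs : 0 ≤ s) (hsu : s ≤ u) (hut : u ≤ t) (ht : t ≤ 1)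
    (hδ : t - s ≤ δ) : ‖μ t u + μ u s - μ t s‖ ≤ c₀ * δ ^ a := by
  refine (hadd s u t hs hsu hut ht).trans ?_
  have := Real.rpow_le_rpow (z := a) (by linarith) hδ (by linarith)
  gcongr

lemma sum_range_two_mul (f : ℕ → V) (N : ℕ) :
    ∑ k ∈ range (2 * N), f k = ∑ k ∈ range N, (f (2 * k) + f (2 * k + 1)) := by
  induction N with
  | zero => simp
  | succ N ih => rw [Nat.mul_succ, sum_range_succ, sum_range_succ, ih, sum_range_succ, add_assoc]

lemma AlmostAdditive.norm_dyadicSum_succ_sub_le (hadd : AlmostAdditive μ c₀ a) (hc₀ : 0 < c₀)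
    (ha : 1 < a) {t : ℝ} (ht0 : 0 ≤ t) (ht1 : t ≤ 1) (n : ℕ) :
    ‖dyadicSum μ (n + 1) t - dyadicSum μ n t‖ ≤ c₀ * ((2 : ℝ) ^ (1 - a)) ^ n := by
  rw [dyadicSum, dyadicSum, pow_succ' 2 n, sum_range_two_mul, ← sum_sub_distrib]
  refine norm_sum_range_two_pow_le fun k _ => ?_
  have hN : (0 : ℝ) < 2 ^ n := by positivity
  have e0 : ((2 * k : ℕ) : ℝ) / 2 ^ (n + 1) = (k : ℕ) / 2 ^ n := by
    push_cast; rw [pow_succ']; field_simp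
  have e1 : ((2 * k + 1 + 1 : ℕ) : ℝ) / 2 ^ (n + 1) = (k + 1 : ℕ) / 2 ^ n := by
    push_cast; rw [pow_succ']; field_simp; ring
  rw [e0, e1, add_comm (μ _ _)]
  have hk : ((k + 1 : ℕ) : ℝ) / 2 ^ n = k / 2 ^ n + 1 / 2 ^ n := by push_cast; ring
  refine hadd.norm_le_of_sub_le hc₀ ha (le_min ht0 (by positivity)) ?_ ?_
    ((min_le_left _ _).trans ht1) ?_
  · rw [← e0]; gcongr; omega
  · rw [← e1]; gcongr; omega
  · rw [hk]
    have : (0 : ℝ) < 1 / 2 ^ n := by positivity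
    rcases le_total t (k / 2 ^ n) with h | h
    · rw [min_eq_left h]
      linarith [min_le_left t (k / 2 ^ n + 1 / 2 ^ n)]
    · rw [min_eq_right h]
      linarith [min_le_right t (k / 2 ^ n + 1 / 2 ^ n)]

lemma AlmostAdditive.norm_dyadicSum_sub_le (hadd : AlmostAdditive μ c₀ a) (hc₀ : 0 < c₀)
    (ha : 1 < a) {s t : ℝ} (hs : 0 ≤ s) (hst : s ≤ t) (ht1 : t ≤ 1) (n : ℕ) :
    ‖dyadicSum μ n t - dyadicSum μ n s - μ t s‖ ≤ c₀ * ((2 : ℝ) ^ (1 - a)) ^ n +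
      2 * c₀ / (1 - (2 : ℝ) ^ (1 - a)) * (t - s) ^ a := by
  set x : ℕ → ℝ := fun k => max s (min t (k / 2 ^ n)) with hxdef
  have hx : Monotone x := fun i j hij => by
    simp only [hxdef]; gcongr
  have hpart := hadd.norm_sum_Ico_sub_le hc₀ ha hx (fun k => hs.trans (le_max_left _ _))
    (fun k => max_le (hst.trans ht1) ((min_le_left _ _).trans ht1)) (Nat.zero_le (2 ^ n))
  have hx0 : x 0 = s := by simp [hxdef, hs, hs.trans hst]
  have hxN : x (2 ^ n) = t := by simp [hxdef, ht1, hst]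
  rw [hx0, hxN, ← range_eq_Ico] at hpart
  have hcells : ‖∑ k ∈ range (2 ^ n), (μ (min t ((k + 1 : ℕ) / 2 ^ n)) (min t ((k : ℕ) / 2 ^ n)) -
      μ (min s ((k + 1 : ℕ) / 2 ^ n)) (min s ((k : ℕ) / 2 ^ n)) - μ (x (k + 1)) (x k))‖ ≤
      c₀ * ((2 : ℝ) ^ (1 - a)) ^ n := by
    refine norm_sum_range_two_pow_le fun k _ => ?_
    have hk : ((k + 1 : ℕ) : ℝ) / 2 ^ n = k / 2 ^ n + 1 / 2 ^ n := by push_cast; ring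
    have hd : (0 : ℝ) < 1 / 2 ^ n := by positivity
    have hp0 : (0 : ℝ) ≤ k / 2 ^ n := by positivity
    simp only [hxdef, hk]
    set δ : ℝ := 1 / 2 ^ n
    set p : ℝ := k / 2 ^ n
    have hnn : 0 ≤ c₀ * δ ^ a := by positivity
    have hss := hadd.apply_self ha hs (hst.trans ht1)
    rcases le_total s p with hsp | hps
    · rw [min_eq_left hsp, min_eq_left (by linarith : s ≤ p + δ), hss,
        max_eq_right (le_min hst hsp), max_eq_right (le_min hst (by linarith))]
      simpa using hnn
    rcases le_total (p + δ) s with hqs | hsq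
    · rw [min_eq_right hqs, min_eq_right hps, min_eq_right (hqs.trans hst),
        min_eq_right (hps.trans hst), max_eq_left hqs, max_eq_left hps, hss]
      simpa using hnn
    · rw [min_eq_left hsq, min_eq_right hps, min_eq_right (hps.trans hst),
        max_eq_left hps, max_eq_right (le_min hst hsq), sub_sub, norm_sub_rev, add_comm]
      refine hadd.norm_le_of_sub_le hc₀ ha hp0 hps (le_min hst hsq)
        ((min_le_left _ _).trans ht1) ?_
      linarith [min_le_right t (p + δ)]
  have hsplit : dyadicSum μ n t - dyadicSum μ n s - μ t s =
      ∑ k ∈ range (2 ^ n), (μ (min t ((k + 1 : ℕ) / 2 ^ n)) (min t ((k : ℕ) / 2 ^ n)) -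
        μ (min s ((k + 1 : ℕ) / 2 ^ n)) (min s ((k : ℕ) / 2 ^ n)) - μ (x (k + 1)) (x k)) +
      (∑ k ∈ range (2 ^ n), μ (x (k + 1)) (x k) - μ t s) := by
    rw [sum_sub_distrib, sum_sub_distrib, dyadicSum, dyadicSum]
    abel
  rw [hsplit]
  exact (norm_add_le _ _).trans (add_le_add hcells hpart)

/-- A function on `[0, 1]` that is Hölder continuous of order `a > 1` and vanishes at `0` is zero. -/
lemma eq_zero_of_norm_sub_le {d : ℝ → V} {C : ℝ} (hC : 0 ≤ C) (ha : 1 < a) (hd0 : d 0 = 0)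
    (hd : ∀ s t, 0 ≤ s → s ≤ t → t ≤ 1 → ‖d t - d s‖ ≤ C * (t - s) ^ a)
    {t : ℝ} (ht0 : 0 ≤ t) (ht1 : t ≤ 1) : d t = 0 := by
  have hbound (n : ℕ) : ‖d t‖ ≤ C * ((2 : ℝ) ^ (1 - a)) ^ n := by
    have htel := sum_range_sub (fun k : ℕ => d (t * (k / 2 ^ n))) (2 ^ n)
    have hlast : t * (((2 ^ n : ℕ) : ℝ) / 2 ^ n) = t := by simp
    rw [hlast, Nat.cast_zero, zero_div, mul_zero, hd0, sub_zero] at htel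
    rw [← htel]
    refine norm_sum_range_two_pow_le fun k hk => ?_
    have hk1 : ((k + 1 : ℕ) : ℝ) / 2 ^ n ≤ 1 := by
      rw [div_le_one (by positivity)]
      exact_mod_cast hk
    refine (hd _ _ (by positivity) (by gcongr; omega)
      (mul_le_one₀ ht1 (by positivity) hk1)).trans ?_
    have e : t * (((k + 1 : ℕ) : ℝ) / 2 ^ n) - t * (k / 2 ^ n) = t * (1 / 2 ^ n) := by
      push_cast; ring
    rw [e]
    have : t * (1 / 2 ^ n) ≤ 1 / 2 ^ n := mul_le_of_le_one_left (by positivity) ht1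
    have := Real.rpow_le_rpow (z := a) (by positivity) this (by linarith)
    gcongr
  have hlim : Tendsto (fun n : ℕ => C * ((2 : ℝ) ^ (1 - a)) ^ n) atTop (𝓝 (C * 0)) :=
    (tendsto_pow_atTop_nhds_zero_of_lt_one (by positivity)
      (two_rpow_one_sub_lt_one ha)).const_mul C
  rw [mul_zero] at hlim
  exact norm_le_zero_iff.mp (ge_of_tendsto' hlim hbound)

lemma AlmostAdditive.exists_tendsto_dyadicSum [CompleteSpace V] (hadd : AlmostAdditive μ c₀ a)
    (hc₀ : 0 < c₀) (ha : 1 < a) {t : ℝ} (ht0 : 0 ≤ t) (ht1 : t ≤ 1) :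
    ∃ v, Tendsto (fun n => dyadicSum μ n t) atTop (𝓝 v) := by
  refine cauchySeq_tendsto_of_complete
    (cauchySeq_of_le_geometric _ c₀ (two_rpow_one_sub_lt_one ha) fun n => ?_)
  rw [dist_eq_norm, norm_sub_rev]
  exact hadd.norm_dyadicSum_succ_sub_le hc₀ ha ht0 ht1 n

end Sewing

variable {V : Type*} [NormedAddCommGroup V] [NormedSpace ℝ V] [CompleteSpace V]

/-- **Sewing lemma.** Given a continuous almost-additive map `μ = (μ_{ts})_{0 ≤ s ≤ t ≤ 1}`,
i.e. `|(μ_{tu} + μ_{us}) - μ_{ts}| ≤ c₀ |t-s|^a` with `a > 1`, there is a unique map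
`φ : [0,1] → V` with `φ 0 = 0` whose increments satisfy `|φ_t - φ_s - μ_{ts}| ≤ c |t-s|^a`
for some constant `c > 0`. -/
theorem sewing_lemma
    (μ : ℝ → ℝ → V)
    (hcont : ContinuousOn (fun q : ℝ × ℝ => μ q.2 q.1)
      {q : ℝ × ℝ | 0 ≤ q.1 ∧ q.1 ≤ q.2 ∧ q.2 ≤ 1})
    (c₀ a : ℝ) (hc₀ : 0 < c₀) (ha : 1 < a)
    (hadd : ∀ s u t, 0 ≤ s → s ≤ u → u ≤ t → t ≤ 1 →
      ‖μ t u + μ u s - μ t s‖ ≤ c₀ * (t - s) ^ a) :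
    ∃ φ : ℝ → V,
      (φ 0 = 0 ∧ ∃ c > (0:ℝ), ∀ s t, 0 ≤ s → s ≤ t → t ≤ 1 →
        ‖φ t - φ s - μ t s‖ ≤ c * (t - s) ^ a) ∧
      ∀ ψ : ℝ → V,
        (ψ 0 = 0 ∧ ∃ c > (0:ℝ), ∀ s t, 0 ≤ s → s ≤ t → t ≤ 1 →
          ‖ψ t - ψ s - μ t s‖ ≤ c * (t - s) ^ a) →
        ∀ t, 0 ≤ t → t ≤ 1 → ψ t = φ t := by
  have hμ : Sewing.AlmostAdditive μ c₀ a := hadd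
  have hr := Sewing.two_rpow_one_sub_lt_one ha
  have hlim : ∀ t : ℝ, ∃ v, 0 ≤ t → t ≤ 1 →
      Filter.Tendsto (fun n => Sewing.dyadicSum μ n t) Filter.atTop (nhds v) := fun t => by
    by_cases ht : 0 ≤ t ∧ t ≤ 1
    · obtain ⟨v, hv⟩ := hμ.exists_tendsto_dyadicSum hc₀ ha ht.1 ht.2
      exact ⟨v, fun _ _ => hv⟩
    · exact ⟨0, fun h0 h1 => absurd ⟨h0, h1⟩ ht⟩
  choose φ hφ using hlim
  have hφ0 : φ 0 = 0 := by
    refine tendsto_nhds_unique (hφ 0 le_rfl zero_le_one)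
      (tendsto_const_nhds.congr fun n => (Finset.sum_eq_zero fun k _ => ?_).symm)
    rw [min_eq_left (by positivity), min_eq_left (by positivity)]
    exact hμ.apply_self ha le_rfl zero_le_one
  have hφμ : ∀ s t, 0 ≤ s → s ≤ t → t ≤ 1 →
      ‖φ t - φ s - μ t s‖ ≤ 2 * c₀ / (1 - (2 : ℝ) ^ (1 - a)) * (t - s) ^ a := by
    intro s t hs hst ht
    have hleft := (((hφ t (hs.trans hst) ht).sub (hφ s hs (hst.trans ht))).sub_const (μ t s)).norm
    have hright := ((tendsto_pow_atTop_nhds_zero_of_lt_one (by positivity) hr).const_mul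
      c₀).add_const (2 * c₀ / (1 - (2 : ℝ) ^ (1 - a)) * (t - s) ^ a)
    rw [mul_zero, zero_add] at hright
    exact le_of_tendsto_of_tendsto' hleft hright (hμ.norm_dyadicSum_sub_le hc₀ ha hs hst ht)
  have hK : 0 < 2 * c₀ / (1 - (2 : ℝ) ^ (1 - a)) := div_pos (by linarith) (by linarith)
  refine ⟨φ, ⟨hφ0, _, hK, hφμ⟩, ?_⟩
  rintro ψ ⟨hψ0, c, hc, hψμ⟩ t ht0 ht1
  refine sub_eq_zero.mp (Sewing.eq_zero_of_norm_sub_le (d := fun t => ψ t - φ t)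
    (add_pos hc hK).le ha (by simp [hψ0, hφ0]) (fun s t hs hst ht => ?_) ht0 ht1)
  rw [show ψ t - φ t - (ψ s - φ s) = (ψ t - ψ s - μ t s) - (φ t - φ s - μ t s) by abel, add_mul]
  exact (norm_sub_le _ _).trans (add_le_add (hψμ s t hs hst ht) (hφμ s t hs hst ht))
end

section
/- (Young integral.) Let V and E be Banach spaces, and let α, β ∈ (0,1] with α + β > 1. Let x : [0,1] → L(V,E) be α-Hölder continuous (with values in the continuous linear maps from V to E, equipped with the operator norm) and let y : [0,1] → V be β-Hölder continuous. Then the map μ_{ts} := x_s(y_t − y_s) satisfies the almost-additivity estimate |(μ_{tu} + μ_{us}) − μ_{ts}| ≤ ‖x‖_α ‖y‖_β |t−s|^{α+β} for all 0≤s≤u≤t≤1, and consequently there exists a unique map φ : [0,1] → E with φ₀ = 0 such that, for some constant c>0, |φ_t − φ_s − x_s(y_t − y_s)| ≤ c|t−s|^{α+β} for all 0≤s≤t≤1 (the Young integral φ_t = ∫₀ᵗ x_s dy_s). -/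
/-!
# The Young integral

The existence part rests on the sewing lemma: an almost additive function of two variables with
exponent `θ > 1` is uniformly close to the increments of a path.
-/

open Filter Topology Finset

theorem two_mul_half_rpow_lt_one {θ : ℝ} (hθ : 1 < θ) : 2 * (1 / 2 : ℝ) ^ θ < 1 := by
  have h := Real.rpow_lt_rpow_of_exponent_gt (x := (1 / 2 : ℝ)) (by norm_num) (by norm_num) hθ
  rw [Real.rpow_one] at h
  linarith

theorem two_pow_mul_half_pow_rpow (K θ : ℝ) (n : ℕ) :
    (2 : ℝ) ^ n * (K * ((1 / 2 : ℝ) ^ n) ^ θ) = K * (2 * (1 / 2 : ℝ) ^ θ) ^ n := by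
  have h : ((1 / 2 : ℝ) ^ n) ^ θ = ((1 / 2 : ℝ) ^ θ) ^ n := by
    rw [← Real.rpow_natCast, ← Real.rpow_mul (by norm_num), mul_comm,
      Real.rpow_mul (by norm_num), Real.rpow_natCast]
  rw [h, mul_pow]
  ring

theorem tendsto_const_mul_two_mul_half_rpow_pow (K : ℝ) {θ : ℝ} (hθ : 1 < θ) :
    Tendsto (fun n : ℕ ↦ K * (2 * (1 / 2 : ℝ) ^ θ) ^ n) atTop (𝓝 0) := by
  simpa using (tendsto_pow_atTop_nhds_zero_of_lt_one (by positivity)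
    (two_mul_half_rpow_lt_one hθ)).const_mul K

theorem sum_range_two_mul {M : Type*} [AddCommMonoid M] (f : ℕ → M) (n : ℕ) :
    ∑ i ∈ range (2 * n), f i = ∑ i ∈ range n, (f (2 * i) + f (2 * i + 1)) := by
  induction n with
  | zero => simp
  | succ n ih => rw [Nat.mul_succ, sum_range_succ, sum_range_succ, ih, sum_range_succ, add_assoc]

/-- A two-parameter function `μ` on `0 ≤ s ≤ t ≤ 1` is almost additive with constant `K` and
exponent `θ`. -/
def AlmostAdditive {F : Type*} [NormedAddCommGroup F] (K θ : ℝ) (μ : ℝ → ℝ → F) : Prop :=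
  ∀ s u t, 0 ≤ s → s ≤ u → u ≤ t → t ≤ 1 → ‖μ s u + μ u t - μ s t‖ ≤ K * (t - s) ^ θ

namespace AlmostAdditive

variable {F : Type*} [NormedAddCommGroup F] {K θ : ℝ} {μ : ℝ → ℝ → F}

theorem self_eq_zero (h : AlmostAdditive K θ μ) (hθ : 1 < θ) {s : ℝ} (h0 : 0 ≤ s) (h1 : s ≤ 1) :
    μ s s = 0 := by
  have := h s s s h0 le_rfl le_rfl h1
  rwa [add_sub_cancel_right, sub_self, Real.zero_rpow (by linarith), mul_zero,
    norm_le_zero_iff] at this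

theorem const_nonneg (h : AlmostAdditive K θ μ) : 0 ≤ K := by
  have := (norm_nonneg _).trans (h 0 0 1 le_rfl le_rfl zero_le_one le_rfl)
  simpa using this

/-- Young's maximal inequality: Riemann sums along a subdivision of an interval differ from the
one-step value by at most a constant independent of the subdivision. -/
theorem norm_sum_Ico_sub_le (h : AlmostAdditive K θ μ) (hθ : 1 < θ) {τ : ℕ → ℝ} (hτ : Monotone τ)
    (hτ0 : ∀ i, 0 ≤ τ i) (hτ1 : ∀ i, τ i ≤ 1) {m n : ℕ} (hmn : m ≤ n) :
    ‖∑ i ∈ Ico m n, μ (τ i) (τ (i + 1)) - μ (τ m) (τ n)‖ ≤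
      2 * K / (1 - 2 * (1 / 2 : ℝ) ^ θ) * (τ n - τ m) ^ θ := by
  have hr := two_mul_half_rpow_lt_one hθ
  have hK := h.const_nonneg
  set C := 2 * K / (1 - 2 * (1 / 2 : ℝ) ^ θ) with hC
  have hC0 : 0 ≤ C := div_nonneg (by positivity) (by linarith)
  have hCK : C * (1 - 2 * (1 / 2 : ℝ) ^ θ) = 2 * K := div_mul_cancel₀ _ (by linarith)
  induction hd : n - m using Nat.strong_induction_on generalizing m n with
  | _ d ih =>
  rcases hmn.eq_or_lt with rfl | hlt
  · simp [h.self_eq_zero hθ (hτ0 m) (hτ1 m), Real.zero_rpow (by linarith : θ ≠ 0)]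
  have hL : 0 ≤ τ n - τ m := sub_nonneg.2 (hτ hmn)
  classical
  have hex : ∃ j, m ≤ j ∧ (τ m + τ n) / 2 ≤ τ (j + 1) :=
    ⟨n - 1, by omega, by rw [Nat.sub_add_cancel (by omega)]; linarith⟩
  obtain ⟨hmj, hright⟩ := Nat.find_spec hex
  have hjn : Nat.find hex ≤ n - 1 :=
    Nat.find_min' hex ⟨by omega, by rw [Nat.sub_add_cancel (by omega)]; linarith⟩
  have hmin := fun k ↦ Nat.find_min (m := k) hex
  generalize Nat.find hex = j at *
  have hleft : τ j ≤ (τ m + τ n) / 2 := by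
    rcases hmj.eq_or_lt with rfl | hmj'
    · linarith
    · have := hmin (j - 1) (by omega)
      rw [Nat.sub_add_cancel (by omega)] at this
      by_contra! hcon
      exact this ⟨by omega, hcon.le⟩
  have hhalf : ∀ ℓ : ℝ, 0 ≤ ℓ → ℓ ≤ (τ n - τ m) / 2 →
      C * ℓ ^ θ ≤ C * ((1 / 2 : ℝ) ^ θ * (τ n - τ m) ^ θ) := fun ℓ h0 hℓ ↦ by
    rw [← Real.mul_rpow (by norm_num) hL]
    exact mul_le_mul_of_nonneg_left (Real.rpow_le_rpow h0 (by linarith) (by linarith)) hC0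
  have e₁ := (ih (j - m) (by omega) hmj rfl).trans
    (hhalf _ (sub_nonneg.2 (hτ hmj)) (by linarith))
  have e₂ := (ih (n - (j + 1)) (by omega) (by omega : j + 1 ≤ n) rfl).trans
    (hhalf _ (sub_nonneg.2 (hτ (by omega))) (by linarith))
  have e₃ : ‖μ (τ m) (τ j) + μ (τ j) (τ (j + 1)) - μ (τ m) (τ (j + 1))‖ ≤ K * (τ n - τ m) ^ θ :=
    (h _ _ _ (hτ0 _) (hτ hmj) (hτ (by omega)) (hτ1 _)).trans <|
      mul_le_mul_of_nonneg_left (Real.rpow_le_rpow (sub_nonneg.2 (hτ (by omega)))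
        (by linarith [hτ (by omega : j + 1 ≤ n)]) (by linarith)) hK
  have e₄ := h (τ m) (τ (j + 1)) (τ n) (hτ0 _) (hτ (by omega)) (hτ (by omega)) (hτ1 _)
  rw [← sum_Ico_consecutive _ hmj (by omega : j ≤ n), sum_eq_sum_Ico_succ_bot (by omega : j < n)]
  calc _ = ‖(∑ i ∈ Ico m j, μ (τ i) (τ (i + 1)) - μ (τ m) (τ j)) +
        (∑ i ∈ Ico (j + 1) n, μ (τ i) (τ (i + 1)) - μ (τ (j + 1)) (τ n)) +
        (μ (τ m) (τ j) + μ (τ j) (τ (j + 1)) - μ (τ m) (τ (j + 1))) +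
        (μ (τ m) (τ (j + 1)) + μ (τ (j + 1)) (τ n) - μ (τ m) (τ n))‖ := by congr 1; abel
    _ ≤ _ := norm_add₄_le
    _ ≤ C * ((1 / 2 : ℝ) ^ θ * (τ n - τ m) ^ θ) + C * ((1 / 2 : ℝ) ^ θ * (τ n - τ m) ^ θ) +
        K * (τ n - τ m) ^ θ + K * (τ n - τ m) ^ θ := by gcongr
    _ = C * (τ n - τ m) ^ θ := by linear_combination (-(τ n - τ m) ^ θ) * hCK

/-- Restricting a cell `[a, b]` to `[0, t]`, to `[0, s]` and to `[s, t]` is additive up to the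
almost-additivity defect of the cell. -/
theorem norm_min_sub_min_sub_max_le (h : AlmostAdditive K θ μ) (hθ : 1 < θ) {a b s t : ℝ}
    (ha : 0 ≤ a) (hab : a ≤ b) (hs : 0 ≤ s) (hst : s ≤ t) (ht : t ≤ 1) :
    ‖μ (min t a) (min t b) - μ (min s a) (min s b) -
      μ (max s (min t a)) (max s (min t b))‖ ≤ K * (b - a) ^ θ := by
  have hK := h.const_nonneg
  have hR : 0 ≤ K * (b - a) ^ θ := mul_nonneg hK (Real.rpow_nonneg (sub_nonneg.2 hab) _)
  have hss := h.self_eq_zero hθ hs (hst.trans ht)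
  rcases le_total s a with hsa | hsa
  · simpa [hsa, hsa.trans hab, hst, hss] using hR
  rcases le_total b s with hbs | hbs
  · simpa [hsa, hbs, hsa.trans hst, hbs.trans hst, hss] using hR
  have hd := h a s (min t b) ha hsa (le_min hst hbs) ((min_le_left _ _).trans ht)
  rw [min_eq_right (hsa.trans hst), min_eq_right hsa, min_eq_left hbs, max_eq_left hsa,
    max_eq_right (le_min hst hbs), sub_sub, norm_sub_rev]
  refine hd.trans (mul_le_mul_of_nonneg_left (Real.rpow_le_rpow ?_ ?_ (by linarith)) hK)
  · linarith [le_min hst hbs]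
  · linarith [min_le_right t b]

end AlmostAdditive

/-- The Riemann sum of `μ` over `[0, t]` along the dyadic subdivision of level `n`. -/
noncomputable def dyadicSum {F : Type*} [AddCommGroup F] (μ : ℝ → ℝ → F) (n : ℕ) (t : ℝ) : F :=
  ∑ i ∈ range (2 ^ n), μ (min t (i * (1 / 2 : ℝ) ^ n)) (min t ((i + 1 : ℕ) * (1 / 2 : ℝ) ^ n))

theorem dyadicSum_zero_right {F : Type*} [AddCommGroup F] {μ : ℝ → ℝ → F} (h : μ 0 0 = 0) (n : ℕ) :
    dyadicSum μ n 0 = 0 :=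
  sum_eq_zero fun i _ ↦ by
    rw [min_eq_left (by positivity), min_eq_left (by positivity), h]

theorem norm_sum_range_two_pow_le {F : Type*} [SeminormedAddCommGroup F] {K θ : ℝ} {n : ℕ}
    {f : ℕ → F} (h : ∀ i, ‖f i‖ ≤ K * ((1 / 2 : ℝ) ^ n) ^ θ) :
    ‖∑ i ∈ range (2 ^ n), f i‖ ≤ K * (2 * (1 / 2 : ℝ) ^ θ) ^ n := by
  rw [← two_pow_mul_half_pow_rpow]
  simpa using norm_sum_le_of_le (range (2 ^ n)) fun i _ ↦ h i

namespace AlmostAdditive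

variable {F : Type*} [NormedAddCommGroup F] {K θ : ℝ} {μ : ℝ → ℝ → F}

theorem dist_dyadicSum_succ_le (h : AlmostAdditive K θ μ) (hθ : 1 < θ) {t : ℝ} (h0 : 0 ≤ t)
    (h1 : t ≤ 1) (n : ℕ) :
    dist (dyadicSum μ n t) (dyadicSum μ (n + 1) t) ≤ K * (2 * (1 / 2 : ℝ) ^ θ) ^ n := by
  rw [dist_comm, dist_eq_norm, dyadicSum, dyadicSum, pow_succ', sum_range_two_mul,
    ← sum_sub_distrib]
  refine norm_sum_range_two_pow_le fun i ↦ ?_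
  have hp : (0 : ℝ) < (1 / 2 : ℝ) ^ n := by positivity
  have ea : ((2 * i : ℕ) : ℝ) * (1 / 2 : ℝ) ^ (n + 1) = i * (1 / 2 : ℝ) ^ n := by
    push_cast; ring
  have eb : ((2 * i + 1 + 1 : ℕ) : ℝ) * (1 / 2 : ℝ) ^ (n + 1) = (i + 1 : ℕ) * (1 / 2 : ℝ) ^ n := by
    push_cast; ring
  have ec : ((2 * i + 1 : ℕ) : ℝ) * (1 / 2 : ℝ) ^ (n + 1) = (i + 1 / 2) * (1 / 2 : ℝ) ^ n := by
    push_cast; ring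
  rw [ea, eb, ec]
  push_cast
  have hb : min t ((i + 1) * (1 / 2 : ℝ) ^ n) ≤ min t (i * (1 / 2 : ℝ) ^ n) + (1 / 2 : ℝ) ^ n := by
    rw [← min_add_add_right]
    exact min_le_min (by linarith) (by linarith)
  have hm₁ : min t (i * (1 / 2 : ℝ) ^ n) ≤ min t ((i + 1 / 2) * (1 / 2 : ℝ) ^ n) :=
    min_le_min le_rfl (by linarith)
  have hm₂ : min t ((i + 1 / 2) * (1 / 2 : ℝ) ^ n) ≤ min t ((i + 1) * (1 / 2 : ℝ) ^ n) :=
    min_le_min le_rfl (by linarith)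
  refine (h _ _ _ (le_min h0 (by positivity)) hm₁ hm₂ ((min_le_left _ _).trans h1)).trans ?_
  exact mul_le_mul_of_nonneg_left
    (Real.rpow_le_rpow (by linarith) (by linarith) (by linarith)) h.const_nonneg

theorem norm_dyadicSum_sub_sub_le (h : AlmostAdditive K θ μ) (hθ : 1 < θ) {s t : ℝ} (hs : 0 ≤ s)
    (hst : s ≤ t) (ht : t ≤ 1) (n : ℕ) :
    ‖dyadicSum μ n t - dyadicSum μ n s - μ s t‖ ≤
      K * (2 * (1 / 2 : ℝ) ^ θ) ^ n + 2 * K / (1 - 2 * (1 / 2 : ℝ) ^ θ) * (t - s) ^ θ := by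
  set τ : ℕ → ℝ := fun i ↦ max s (min t (i * (1 / 2 : ℝ) ^ n)) with hτ
  have hmono : Monotone τ := fun i j hij ↦
    max_le_max le_rfl (min_le_min le_rfl (by gcongr))
  have hτ0 : τ 0 = s := by simp [hτ, hs.trans hst, hs]
  have hτn : τ (2 ^ n) = t := by simp [hτ, ht, hst]
  have e₁ := h.norm_sum_Ico_sub_le hθ hmono (fun i ↦ hs.trans (le_max_left _ _))
    (fun i ↦ max_le (hst.trans ht) ((min_le_left _ _).trans ht)) (Nat.zero_le (2 ^ n))
  rw [hτ0, hτn, Nat.Ico_zero_eq_range] at e₁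
  have e₂ : ‖dyadicSum μ n t - dyadicSum μ n s - ∑ i ∈ range (2 ^ n), μ (τ i) (τ (i + 1))‖ ≤
      K * (2 * (1 / 2 : ℝ) ^ θ) ^ n := by
    rw [dyadicSum, dyadicSum, ← sum_sub_distrib, ← sum_sub_distrib]
    refine norm_sum_range_two_pow_le fun i ↦ ?_
    refine (h.norm_min_sub_min_sub_max_le hθ (by positivity) (by gcongr; omega) hs hst ht).trans
      (le_of_eq ?_)
    congr 2
    push_cast
    ring
  exact (norm_sub_le_norm_sub_add_norm_sub _ _ _).trans (add_le_add e₂ e₁)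

/-- **Sewing lemma**, existence part. -/
theorem exists_norm_sub_sub_le [CompleteSpace F] (h : AlmostAdditive K θ μ) (hθ : 1 < θ) :
    ∃ φ : ℝ → F, φ 0 = 0 ∧ ∃ c > (0 : ℝ), ∀ s t, 0 ≤ s → s ≤ t → t ≤ 1 →
      ‖φ t - φ s - μ s t‖ ≤ c * (t - s) ^ θ := by
  have hr := two_mul_half_rpow_lt_one hθ
  have hlim : ∀ t, 0 ≤ t → t ≤ 1 →
      Tendsto (fun n ↦ dyadicSum μ n t) atTop (𝓝 (limUnder atTop fun n ↦ dyadicSum μ n t)) :=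
    fun t h0 h1 ↦ (cauchySeq_of_le_geometric _ K hr
      (h.dist_dyadicSum_succ_le hθ h0 h1)).tendsto_limUnder
  refine ⟨fun t ↦ limUnder atTop fun n ↦ dyadicSum μ n t, ?_,
    2 * K / (1 - 2 * (1 / 2 : ℝ) ^ θ) + 1, ?_, fun s t hs hst ht ↦ ?_⟩
  · refine tendsto_nhds_unique (hlim 0 le_rfl zero_le_one) ?_
    simp [dyadicSum_zero_right (h.self_eq_zero hθ le_rfl zero_le_one)]
  · have := div_nonneg (mul_nonneg zero_le_two h.const_nonneg) (sub_nonneg.2 hr.le)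
    positivity
  · have hl := (((hlim t (hs.trans hst) ht).sub (hlim s hs (hst.trans ht))).sub_const (μ s t)).norm
    have hu := (tendsto_const_mul_two_mul_half_rpow_pow K hθ).add_const
      (2 * K / (1 - 2 * (1 / 2 : ℝ) ^ θ) * (t - s) ^ θ)
    have := le_of_tendsto_of_tendsto' hl hu (h.norm_dyadicSum_sub_sub_le hθ hs hst ht)
    have hp := Real.rpow_nonneg (sub_nonneg.2 hst) θ
    linarith

end AlmostAdditive

/-- A path on `[0, 1]` which is Hölder continuous of exponent greater than `1` is constant. -/
theorem eq_of_norm_sub_le_rpow {F : Type*} [NormedAddCommGroup F] {c θ : ℝ} (hθ : 1 < θ)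
    {d : ℝ → F} (h : ∀ s t, 0 ≤ s → s ≤ t → t ≤ 1 → ‖d t - d s‖ ≤ c * (t - s) ^ θ) {t : ℝ}
    (h0 : 0 ≤ t) (h1 : t ≤ 1) : d t = d 0 := by
  have hc : 0 ≤ c := by simpa using (norm_nonneg _).trans (h 0 1 le_rfl zero_le_one le_rfl)
  have hadd : AlmostAdditive 0 θ fun s t ↦ d t - d s := fun s u t _ _ _ _ ↦ by simp
  have hbound : ∀ n : ℕ, ‖d t - d 0‖ ≤ c * (2 * (1 / 2 : ℝ) ^ θ) ^ n := fun n ↦ by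
    have e := hadd.norm_dyadicSum_sub_sub_le hθ le_rfl h0 h1 n
    rw [dyadicSum_zero_right (μ := fun s t ↦ d t - d s) (sub_self _), sub_zero] at e
    simp only [zero_mul, mul_zero, zero_div, add_zero, norm_le_zero_iff, sub_eq_zero] at e
    rw [← e]
    refine norm_sum_range_two_pow_le fun i ↦ ?_
    have hp : (0 : ℝ) < (1 / 2 : ℝ) ^ n := by positivity
    have hm : min t (i * (1 / 2 : ℝ) ^ n) ≤ min t ((i + 1 : ℕ) * (1 / 2 : ℝ) ^ n) :=
      min_le_min le_rfl (by gcongr; omega)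
    have hb : min t ((i + 1 : ℕ) * (1 / 2 : ℝ) ^ n) ≤
        min t (i * (1 / 2 : ℝ) ^ n) + (1 / 2 : ℝ) ^ n := by
      rw [← min_add_add_right]
      exact min_le_min (by linarith) (by push_cast; linarith)
    refine (h _ _ (le_min h0 (by positivity)) hm ((min_le_left _ _).trans h1)).trans ?_
    exact mul_le_mul_of_nonneg_left
      (Real.rpow_le_rpow (by linarith) (by linarith) (by linarith)) hc
  have := ge_of_tendsto' (tendsto_const_mul_two_mul_half_rpow_pow c hθ) hbound
  exact sub_eq_zero.1 (norm_le_zero_iff.1 this)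

variable {V : Type*} [NormedAddCommGroup V] [NormedSpace ℝ V] [CompleteSpace V]
variable {E : Type*} [NormedAddCommGroup E] [NormedSpace ℝ E] [CompleteSpace E]

/-- **Young integral.** If `x : [0,1] → L(V,E)` is `α`-Hölder and `y : [0,1] → V` is
`β`-Hölder with `α + β > 1`, then `μ_{ts} = x_s (y_t - y_s)` is almost additive with
`|(μ_{tu} + μ_{us}) - μ_{ts}| ≤ ‖x‖_α ‖y‖_β |t-s|^{α+β}`, and there is a unique map
`φ : [0,1] → E` with `φ 0 = 0` and `|φ_t - φ_s - x_s (y_t - y_s)| ≤ c |t-s|^{α+β}`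
for some `c > 0`; `φ_t` is the Young integral `∫₀ᵗ x dy`. -/
theorem young_integral
    (α β : ℝ) (hα0 : 0 < α) (hα1 : α ≤ 1) (hβ0 : 0 < β) (hβ1 : β ≤ 1) (hαβ : 1 < α + β)
    (x : ℝ → V →L[ℝ] E) (y : ℝ → V) (Kx Ky : ℝ)
    (hx : ∀ s t, 0 ≤ s → s ≤ 1 → 0 ≤ t → t ≤ 1 → ‖x t - x s‖ ≤ Kx * |t - s| ^ α)
    (hy : ∀ s t, 0 ≤ s → s ≤ 1 → 0 ≤ t → t ≤ 1 → ‖y t - y s‖ ≤ Ky * |t - s| ^ β) :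
    (∀ s u t, 0 ≤ s → s ≤ u → u ≤ t → t ≤ 1 →
      ‖x u (y t - y u) + x s (y u - y s) - x s (y t - y s)‖ ≤
        Kx * Ky * (t - s) ^ (α + β)) ∧
    ∃ φ : ℝ → E,
      (φ 0 = 0 ∧ ∃ c > (0:ℝ), ∀ s t, 0 ≤ s → s ≤ t → t ≤ 1 →
        ‖φ t - φ s - x s (y t - y s)‖ ≤ c * (t - s) ^ (α + β)) ∧
      ∀ ψ : ℝ → E,
        (ψ 0 = 0 ∧ ∃ c > (0:ℝ), ∀ s t, 0 ≤ s → s ≤ t → t ≤ 1 →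
          ‖ψ t - ψ s - x s (y t - y s)‖ ≤ c * (t - s) ^ (α + β)) →
        ∀ t, 0 ≤ t → t ≤ 1 → ψ t = φ t := by
  have hadd : ∀ s u t, 0 ≤ s → s ≤ u → u ≤ t → t ≤ 1 →
      ‖x u (y t - y u) + x s (y u - y s) - x s (y t - y s)‖ ≤
        Kx * Ky * (t - s) ^ (α + β) := by
    intro s u t hs hsu hut ht
    have hKx : 0 ≤ Kx := by
      simpa using (norm_nonneg _).trans (hx 0 1 le_rfl zero_le_one zero_le_one le_rfl)
    have hKy : 0 ≤ Ky := by
      simpa using (norm_nonneg _).trans (hy 0 1 le_rfl zero_le_one zero_le_one le_rfl)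
    have hxu : ‖x u - x s‖ ≤ Kx * (t - s) ^ α := by
      refine (hx s u hs (by linarith) (by linarith) (by linarith)).trans ?_
      rw [abs_of_nonneg (by linarith)]
      exact mul_le_mul_of_nonneg_left
        (Real.rpow_le_rpow (by linarith) (by linarith) hα0.le) hKx
    have hyt : ‖y t - y u‖ ≤ Ky * (t - s) ^ β := by
      refine (hy u t (by linarith) (by linarith) (by linarith) ht).trans ?_
      rw [abs_of_nonneg (by linarith)]
      exact mul_le_mul_of_nonneg_left
        (Real.rpow_le_rpow (by linarith) (by linarith) hβ0.le) hKy
    calc _ = ‖(x u - x s) (y t - y u)‖ := by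
          congr 1
          simp only [sub_apply, map_sub]
          abel
      _ ≤ ‖x u - x s‖ * ‖y t - y u‖ := (x u - x s).le_opNorm _
      _ ≤ (Kx * (t - s) ^ α) * (Ky * (t - s) ^ β) :=
          mul_le_mul hxu hyt (norm_nonneg _) ((norm_nonneg _).trans hxu)
      _ = _ := by
          rw [Real.rpow_add_of_nonneg (by linarith) hα0.le hβ0.le]
          ring
  refine ⟨hadd, ?_⟩
  have hμ : AlmostAdditive (Kx * Ky) (α + β) fun s t ↦ x s (y t - y s) :=
    fun s u t hs hsu hut ht ↦ by
      rw [add_comm (x s (y u - y s))]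
      exact hadd s u t hs hsu hut ht
  obtain ⟨φ, hφ0, c, hc, hφ⟩ := hμ.exists_norm_sub_sub_le hαβ
  refine ⟨φ, ⟨hφ0, c, hc, hφ⟩, ?_⟩
  rintro ψ ⟨hψ0, c', -, hψ⟩ t h0 h1
  have hconst := eq_of_norm_sub_le_rpow (d := fun t ↦ ψ t - φ t) (c := c' + c) hαβ
    (fun s t hs hst ht ↦ ?_) h0 h1
  · simpa [hψ0, hφ0, sub_eq_zero] using hconst
  · calc ‖ψ t - φ t - (ψ s - φ s)‖
        = ‖(ψ t - ψ s - x s (y t - y s)) - (φ t - φ s - x s (y t - y s))‖ := by congr 1; abel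
      _ ≤ _ := norm_sub_le _ _
      _ ≤ c' * (t - s) ^ (α + β) + c * (t - s) ^ (α + β) :=
          add_le_add (hψ s t hs hst ht) (hφ s t hs hst ht)
      _ = _ := by ring
end

section
/- (Canonical rough path above a controlled path.) Let 2<p<3, let (X,𝕏) be a Hölder p-rough path over ℝ^ℓ on [0,T], and let (z,Z') be an ℝ^d-valued path controlled by X, with increments Z_{ts} := z_t − z_s. Then there exists a continuous map ℤ : Δ_T → ℝ^d⊗ℝ^d, unique with the following two properties: (i) ℤ satisfies the Chen relation ℤ_{ts} = ℤ_{tu} + ℤ_{us} + Z_{us}⊗Z_{tu} for all 0≤s≤u≤t≤T, and (ii) for some constant c>0, |ℤ_{ts} − (Z'_s ⊗ Z'_s)(𝕏_{ts})| ≤ c|t−s|^{3/p} for all (s,t)∈Δ_T, where Z'_s ⊗ Z'_s : ℝ^ℓ⊗ℝ^ℓ → ℝ^d⊗ℝ^d is the linear map determined by (Z'_s⊗Z'_s)(a⊗b) = (Z'_s a)⊗(Z'_s b). Moreover the pair (Z, ℤ) is then a Hölder p-rough path over ℝ^d. -/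
/-!
Statement 11: the canonical rough path above a controlled path (proposition 3.8).
-/

noncomputable section

/-- Tensor product `a ⊗ b ∈ ℝ^d ⊗ ℝ^d` of two vectors of `ℝ^d`, in coordinates. -/
def tensor2 {d : ℕ} (a b : EuclideanSpace ℝ (Fin d)) :
    EuclideanSpace ℝ (Fin d × Fin d) :=
  (WithLp.equiv 2 (Fin d × Fin d → ℝ)).symm (fun q : Fin d × Fin d => a q.1 * b q.2)

/-- The map `A ⊗ A : ℝ^ℓ ⊗ ℝ^ℓ → ℝ^d ⊗ ℝ^d` induced by a linear map `A : ℝ^ℓ → ℝ^d`,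
determined by `(A ⊗ A)(a ⊗ b) = (A a) ⊗ (A b)`, in coordinates. -/
def tensorPush {ℓ d : ℕ} (A : EuclideanSpace ℝ (Fin ℓ) →L[ℝ] EuclideanSpace ℝ (Fin d))
    (M : EuclideanSpace ℝ (Fin ℓ × Fin ℓ)) : EuclideanSpace ℝ (Fin d × Fin d) :=
  (WithLp.equiv 2 (Fin d × Fin d → ℝ)).symm
    (fun q : Fin d × Fin d => ∑ k : Fin ℓ, ∑ l : Fin ℓ,
      A (EuclideanSpace.single k 1) q.1 * A (EuclideanSpace.single l 1) q.2 * M (k, l))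

/-- The two defining properties of the canonical lift `ℤ` of a controlled path `(z, Z')`:
(i) the Chen relation `ℤ_{ts} = ℤ_{tu} + ℤ_{us} + Z_{us} ⊗ Z_{tu}`, and (ii) the local
expansion `|ℤ_{ts} - (Z'_s ⊗ Z'_s) 𝕏_{ts}| ≤ c |t-s|^{3/p}`. -/
def IsLift (ℓ d : ℕ) (T p : ℝ)
    (XX : ℝ → ℝ → EuclideanSpace ℝ (Fin ℓ × Fin ℓ))
    (z : ℝ → EuclideanSpace ℝ (Fin d))
    (Z' : ℝ → EuclideanSpace ℝ (Fin ℓ) →L[ℝ] EuclideanSpace ℝ (Fin d))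
    (ZZ : ℝ → ℝ → EuclideanSpace ℝ (Fin d × Fin d)) : Prop :=
  (∀ s u t : ℝ, 0 ≤ s → s ≤ u → u ≤ t → t ≤ T →
    ZZ t s = ZZ t u + ZZ u s + tensor2 (z u - z s) (z t - z u)) ∧
  (∃ c > (0:ℝ), ∀ s t : ℝ, 0 ≤ s → s ≤ t → t ≤ T →
    ‖ZZ t s - tensorPush (Z' s) (XX t s)‖ ≤ c * (t - s) ^ (3 / p))

section Sewing

open Filter Topology

theorem two_mul_half_rpow {L : ℝ} (hL : 0 ≤ L) (θ : ℝ) :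
    2 * (L / 2) ^ θ = 2 ^ (1 - θ) * L ^ θ := by
  rw [Real.div_rpow hL (by norm_num), Real.rpow_sub (by norm_num), Real.rpow_one]
  ring

theorem two_rpow_one_sub_lt_one {θ : ℝ} (hθ : 1 < θ) : (2 : ℝ) ^ (1 - θ) < 1 :=
  Real.rpow_lt_one_of_one_lt_of_neg (by norm_num) (by linarith)

theorem exists_le_and_le_succ (x : ℕ → ℝ) (c : ℝ) (i n : ℕ) (hi : x i ≤ c)
    (hn : c ≤ x (i + (n + 1))) :
    ∃ a b : ℕ, a + b = n ∧ x (i + a) ≤ c ∧ c ≤ x (i + a + 1) := by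
  induction n with
  | zero => exact ⟨0, 0, rfl, hi, hn⟩
  | succ n ih =>
    by_cases h : c ≤ x (i + (n + 1))
    · obtain ⟨a, b, hab, h1, h2⟩ := ih h
      exact ⟨a, b + 1, by omega, h1, h2⟩
    · exact ⟨n + 1, 0, by omega, (not_le.mp h).le, hn⟩

variable {E : Type*} [NormedAddCommGroup E]

/-- The constant in the sewing lemma. -/
def sewingConst (C θ : ℝ) : ℝ := 2 * C / (1 - 2 ^ (1 - θ))

theorem sewingConst_nonneg {C θ : ℝ} (hC : 0 ≤ C) (hθ : 1 < θ) : 0 ≤ sewingConst C θ := by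
  have := two_rpow_one_sub_lt_one hθ
  exact div_nonneg (by linarith) (by linarith)

theorem sewingConst_eq {C θ : ℝ} (hθ : 1 < θ) :
    sewingConst C θ * 2 ^ (1 - θ) + 2 * C = sewingConst C θ := by
  have := two_rpow_one_sub_lt_one hθ
  have h : (1 - (2 : ℝ) ^ (1 - θ)) ≠ 0 := by linarith
  unfold sewingConst
  field_simp
  ring

theorem germ_self_eq_zero {T C θ : ℝ} (hθ : 1 < θ) {Ξ : ℝ → ℝ → E}
    (hΞ : ∀ s u t, 0 ≤ s → s ≤ u → u ≤ t → t ≤ T →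
      ‖Ξ s t - Ξ s u - Ξ u t‖ ≤ C * (t - s) ^ θ)
    {s : ℝ} (h0 : 0 ≤ s) (hT : s ≤ T) : Ξ s s = 0 := by
  have h := hΞ s s s h0 le_rfl le_rfl hT
  rw [sub_self s, Real.zero_rpow (by linarith), mul_zero] at h
  simpa using h

/-- Riemann sums of an almost additive germ along a monotone sequence stay close to the germ. -/
theorem norm_sum_germ_sub_le {T C θ : ℝ} (hC : 0 ≤ C) (hθ : 1 < θ) {Ξ : ℝ → ℝ → E}
    (hΞ : ∀ s u t, 0 ≤ s → s ≤ u → u ≤ t → t ≤ T →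
      ‖Ξ s t - Ξ s u - Ξ u t‖ ≤ C * (t - s) ^ θ)
    {x : ℕ → ℝ} (hx : Monotone x) (hx0 : ∀ k, 0 ≤ x k) (hxT : ∀ k, x k ≤ T) (n i : ℕ) :
    ‖∑ k ∈ Finset.range n, Ξ (x (i + k)) (x (i + k + 1)) - Ξ (x i) (x (i + n))‖
      ≤ sewingConst C θ * (x (i + n) - x i) ^ θ := by
  induction n using Nat.strong_induction_on generalizing i with
  | _ n ih =>
  have hK := sewingConst_nonneg hC hθ
  rcases n with _ | n
  · simp only [Finset.range_zero, Finset.sum_empty, add_zero, sub_self]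
    rw [germ_self_eq_zero hθ hΞ (hx0 i) (hxT i), Real.zero_rpow (by linarith)]
    simp
  have hL : 0 ≤ x (i + (n + 1)) - x i := sub_nonneg.mpr (hx (by omega))
  obtain ⟨a, b, hab, h1, h2⟩ := exists_le_and_le_succ x ((x i + x (i + (n + 1))) / 2) i n
    (by linarith) (by linarith)
  have ha := ih a (by omega) i
  have hb := ih b (by omega) (i + a + 1)
  have e : i + a + 1 + b = i + (n + 1) := by omega
  rw [e] at hb
  have m1 : x i ≤ x (i + a) := hx (by omega)
  have m2 : x (i + a) ≤ x (i + a + 1) := hx (by omega)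
  have m3 : x (i + a + 1) ≤ x (i + (n + 1)) := hx (by omega)
  have d1 := hΞ _ _ _ (hx0 i) m1 (m2.trans m3) (hxT (i + (n + 1)))
  have d2 := hΞ _ _ _ (hx0 (i + a)) m2 m3 (hxT (i + (n + 1)))
  have hsum : ∑ k ∈ Finset.range (n + 1), Ξ (x (i + k)) (x (i + k + 1))
      = ∑ k ∈ Finset.range a, Ξ (x (i + k)) (x (i + k + 1)) + Ξ (x (i + a)) (x (i + a + 1))
        + ∑ k ∈ Finset.range b, Ξ (x (i + a + 1 + k)) (x (i + a + 1 + k + 1)) := by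
    rw [show n + 1 = (a + 1) + b by omega, Finset.sum_range_add, Finset.sum_range_succ]
    congr 1
    refine Finset.sum_congr rfl fun k _ => ?_
    rw [show i + (a + 1 + k) = i + a + 1 + k by omega]
  have ha' : (x (i + a) - x i) ^ θ ≤ ((x (i + (n + 1)) - x i) / 2) ^ θ :=
    Real.rpow_le_rpow (by linarith) (by linarith) (by linarith)
  have hb' : (x (i + (n + 1)) - x (i + a + 1)) ^ θ ≤ ((x (i + (n + 1)) - x i) / 2) ^ θ :=
    Real.rpow_le_rpow (by linarith) (by linarith) (by linarith)
  have hd' : (x (i + (n + 1)) - x (i + a)) ^ θ ≤ (x (i + (n + 1)) - x i) ^ θ :=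
    Real.rpow_le_rpow (by linarith) (by linarith) (by linarith)
  have hhalf := two_mul_half_rpow hL θ
  have hconst := sewingConst_eq (C := C) hθ
  rw [hsum]
  generalize x (i + (n + 1)) = xj at *
  calc _ = ‖(∑ k ∈ Finset.range a, Ξ (x (i + k)) (x (i + k + 1)) - Ξ (x i) (x (i + a)))
        + (∑ k ∈ Finset.range b, Ξ (x (i + a + 1 + k)) (x (i + a + 1 + k + 1))
            - Ξ (x (i + a + 1)) xj)
        - (Ξ (x i) xj - Ξ (x i) (x (i + a)) - Ξ (x (i + a)) xj)
        - (Ξ (x (i + a)) xj - Ξ (x (i + a)) (x (i + a + 1)) - Ξ (x (i + a + 1)) xj)‖ := by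
        congr 1; abel
    _ ≤ sewingConst C θ * (x (i + a) - x i) ^ θ + sewingConst C θ * (xj - x (i + a + 1)) ^ θ
        + C * (xj - x i) ^ θ + C * (xj - x (i + a)) ^ θ :=
        norm_sub_le_of_le (norm_sub_le_of_le (norm_add_le_of_le ha hb) d1) d2
    _ ≤ sewingConst C θ * ((xj - x i) / 2) ^ θ + sewingConst C θ * ((xj - x i) / 2) ^ θ
        + C * (xj - x i) ^ θ + C * (xj - x i) ^ θ := by gcongr
    _ = sewingConst C θ * (2 * ((xj - x i) / 2) ^ θ) + 2 * C * (xj - x i) ^ θ := by ring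
    _ = (sewingConst C θ * 2 ^ (1 - θ) + 2 * C) * (xj - x i) ^ θ := by rw [hhalf]; ring
    _ = sewingConst C θ * (xj - x i) ^ θ := by rw [hconst]

theorem Finset.exists_monotone_enumeration (F : Finset ℝ) (hF : F.Nonempty) :
    ∃ x : ℕ → ℝ, Monotone x ∧ (∀ k, x k ∈ F) ∧ ∀ t ∈ F, ∃ k, x k = t := by
  have hpos : 0 < F.card := hF.card_pos
  refine ⟨fun k => F.orderEmbOfFin rfl ⟨min k (F.card - 1), by omega⟩, fun a b hab => ?_,
    fun k => F.orderEmbOfFin_mem rfl _, fun t ht => ?_⟩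
  · refine (F.orderEmbOfFin rfl).monotone ?_
    rw [Fin.mk_le_mk]
    omega
  · have : t ∈ Set.range (F.orderEmbOfFin rfl) := by rwa [F.range_orderEmbOfFin rfl]
    obtain ⟨k, rfl⟩ := this
    refine ⟨k, congrArg _ (Fin.ext ?_)⟩
    have := k.isLt
    simp only
    omega

theorem exists_sewing_on_finset {T C θ : ℝ} (hC : 0 ≤ C) (hθ : 1 < θ) {Ξ : ℝ → ℝ → E}
    (hΞ : ∀ s u t, 0 ≤ s → s ≤ u → u ≤ t → t ≤ T →
      ‖Ξ s t - Ξ s u - Ξ u t‖ ≤ C * (t - s) ^ θ)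
    (F : Finset ℝ) (hF : ∀ t ∈ F, 0 ≤ t ∧ t ≤ T) :
    ∃ J : ℝ → E, ∀ s ∈ F, ∀ t ∈ F, s ≤ t →
      ‖J t - J s - Ξ s t‖ ≤ sewingConst C θ * (t - s) ^ θ := by
  classical
  rcases F.eq_empty_or_nonempty with rfl | hne
  · exact ⟨0, by simp⟩
  obtain ⟨x, hx, hxF, hsurj⟩ := F.exists_monotone_enumeration hne
  choose! κ hκ using hsurj
  have key : ∀ i j, i ≤ j →
      ‖∑ k ∈ Finset.range j, Ξ (x k) (x (k + 1)) - ∑ k ∈ Finset.range i, Ξ (x k) (x (k + 1))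
        - Ξ (x i) (x j)‖ ≤ sewingConst C θ * (x j - x i) ^ θ := by
    intro i j hij
    obtain ⟨n, rfl⟩ := Nat.exists_eq_add_of_le hij
    rw [Finset.sum_range_add, add_sub_cancel_left]
    exact norm_sum_germ_sub_le hC hθ hΞ hx (fun k => (hF _ (hxF k)).1)
      (fun k => (hF _ (hxF k)).2) n i
  refine ⟨fun t => ∑ k ∈ Finset.range (κ t), Ξ (x k) (x (k + 1)), fun s hs t ht hst => ?_⟩
  rcases le_total (κ s) (κ t) with h | h
  · have := key _ _ h
    rwa [hκ s hs, hκ t ht] at this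
  · obtain rfl : s = t := le_antisymm hst (by
      have := hx h
      rwa [hκ s hs, hκ t ht] at this)
    simp only [sub_self, zero_sub, norm_neg]
    rw [germ_self_eq_zero hθ hΞ (hF s hs).1 (hF s hs).2, Real.zero_rpow (by linarith)]
    simp

/-- Sewing lemma: an almost additive germ is close to the increments of a path. -/
theorem exists_sewing [ProperSpace E] {T C θ : ℝ} (hC : 0 ≤ C) (hθ : 1 < θ)
    {Ξ : ℝ → ℝ → E}
    (hΞ : ∀ s u t, 0 ≤ s → s ≤ u → u ≤ t → t ≤ T →
      ‖Ξ s t - Ξ s u - Ξ u t‖ ≤ C * (t - s) ^ θ) :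
    ∃ I : ℝ → E, ∀ s t, 0 ≤ s → s ≤ t → t ≤ T →
      ‖I t - I s - Ξ s t‖ ≤ sewingConst C θ * (t - s) ^ θ := by
  classical
  have hfin := fun F : Finset ℝ => exists_sewing_on_finset hC hθ hΞ
    (F.filter fun t => 0 ≤ t ∧ t ≤ T) (fun t ht => (Finset.mem_filter.mp ht).2)
  choose J hJ using hfin
  let U : Ultrafilter (Finset ℝ) := Ultrafilter.of atTop
  have hU : (U : Filter (Finset ℝ)) ≤ atTop := Ultrafilter.of_le atTop
  have hev : ∀ s t, 0 ≤ s → s ≤ t → t ≤ T → ∀ᶠ F in (U : Filter (Finset ℝ)),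
      ‖J F t - J F s - Ξ s t‖ ≤ sewingConst C θ * (t - s) ^ θ := by
    intro s t hs hst htT
    filter_upwards [hU (eventually_ge_atTop ({s, t} : Finset ℝ))] with F hF
    refine hJ F s (Finset.mem_filter.mpr ⟨hF (by simp), hs, hst.trans htT⟩) t
      (Finset.mem_filter.mpr ⟨hF (by simp), hs.trans hst, htT⟩) hst
  have hlim : ∀ t, ∃ y, 0 ≤ t → t ≤ T → Tendsto (fun F => J F t - J F 0) U (𝓝 y) := by
    intro t
    by_cases ht : 0 ≤ t ∧ t ≤ T
    · obtain ⟨y, -, hy⟩ := (isCompact_closedBall (Ξ 0 t)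
        (sewingConst C θ * (t - 0) ^ θ)).ultrafilter_le_nhds
        (U.map fun F => J F t - J F 0) (by
          rw [le_principal_iff, Ultrafilter.coe_map, mem_map]
          filter_upwards [hev 0 t le_rfl ht.1 ht.2] with F hF
          simpa [dist_eq_norm] using hF)
      exact ⟨y, fun _ _ => hy⟩
    · exact ⟨0, fun h1 h2 => absurd ⟨h1, h2⟩ ht⟩
  choose I hI using hlim
  refine ⟨I, fun s t hs hst htT => ?_⟩
  refine le_of_tendsto (((hI t (hs.trans hst) htT).sub (hI s hs (hst.trans htT))).sub_const
    (Ξ s t)).norm ?_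
  filter_upwards [hev s t hs hst htT] with F hF
  simpa using hF

/-- An additive two-parameter function that is `O(|t - s|^θ)` with `θ > 1` vanishes. -/
theorem eq_zero_of_additive_of_norm_le {T c θ : ℝ} (hθ : 1 < θ) {D : ℝ → ℝ → E}
    (hadd : ∀ s u t, 0 ≤ s → s ≤ u → u ≤ t → t ≤ T → D s t = D s u + D u t)
    (hD : ∀ s t, 0 ≤ s → s ≤ t → t ≤ T → ‖D s t‖ ≤ c * (t - s) ^ θ)
    {s t : ℝ} (hs : 0 ≤ s) (hst : s ≤ t) (ht : t ≤ T) : D s t = 0 := by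
  set q : ℝ := 2 ^ (1 - θ)
  have hq0 : 0 ≤ q := Real.rpow_nonneg (by norm_num) _
  have hn : ∀ n : ℕ, ∀ s t, 0 ≤ s → s ≤ t → t ≤ T → ‖D s t‖ ≤ q ^ n * (c * (t - s) ^ θ) := by
    intro n
    induction n with
    | zero => simpa using hD
    | succ n ih =>
      intro s t hs hst ht
      have h1 := ih s ((s + t) / 2) hs (by linarith) (by linarith)
      have h2 := ih ((s + t) / 2) t (by linarith) (by linarith) ht
      rw [show (s + t) / 2 - s = (t - s) / 2 by ring] at h1
      rw [show t - (s + t) / 2 = (t - s) / 2 by ring] at h2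
      rw [hadd s ((s + t) / 2) t hs (by linarith) (by linarith) ht]
      calc _ ≤ q ^ n * (c * ((t - s) / 2) ^ θ) + q ^ n * (c * ((t - s) / 2) ^ θ) :=
            norm_add_le_of_le h1 h2
        _ = q ^ n * c * (2 * ((t - s) / 2) ^ θ) := by ring
        _ = q ^ (n + 1) * (c * (t - s) ^ θ) := by
            rw [two_mul_half_rpow (by linarith)]; ring
  have hlim : Tendsto (fun n : ℕ => q ^ n * (c * (t - s) ^ θ)) atTop (𝓝 0) := by
    simpa using (tendsto_pow_atTop_nhds_zero_of_lt_one hq0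
      (two_rpow_one_sub_lt_one hθ)).mul_const (c * (t - s) ^ θ)
  exact norm_le_zero_iff.mp (ge_of_tendsto' hlim fun n => hn n s t hs hst ht)

theorem continuousOn_Icc_of_norm_sub_le_rpow {T K r : ℝ} (hr : 0 < r) {f : ℝ → E}
    (hf : ∀ s t, 0 ≤ s → s ≤ t → t ≤ T → ‖f t - f s‖ ≤ K * (t - s) ^ r) :
    ContinuousOn f (Set.Icc 0 T) := by
  intro a ha
  have hlim : Tendsto (fun x : ℝ => K * |x - a| ^ r) (𝓝[Set.Icc 0 T] a) (𝓝 0) := by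
    have h : Continuous fun x : ℝ => K * |x - a| ^ r :=
      continuous_const.mul ((continuous_id.sub continuous_const).abs.rpow_const
        fun _ => Or.inr hr.le)
    have := (h.tendsto a).mono_left (nhdsWithin_le_nhds (s := Set.Icc 0 T))
    simpa [Real.zero_rpow hr.ne'] using this
  refine tendsto_iff_norm_sub_tendsto_zero.mpr (squeeze_zero' ?_ ?_ hlim)
  · exact Eventually.of_forall fun _ => norm_nonneg _
  · filter_upwards [self_mem_nhdsWithin] with x hx
    rcases le_total a x with h | h
    · rw [abs_of_nonneg (by linarith)]
      exact hf a x ha.1 h hx.2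
    · rw [abs_of_nonpos (by linarith), norm_sub_rev, neg_sub]
      exact hf x a hx.1 h ha.2

end Sewing

section Tensor

variable {ℓ d : ℕ}

@[simp]
theorem tensor2_apply (a b : EuclideanSpace ℝ (Fin d)) (q : Fin d × Fin d) :
    tensor2 a b q = a q.1 * b q.2 := rfl

theorem tensor2_sub_left (a a' b : EuclideanSpace ℝ (Fin d)) :
    tensor2 (a - a') b = tensor2 a b - tensor2 a' b := by
  ext q; simp [sub_mul]

theorem tensor2_sub_right (a b b' : EuclideanSpace ℝ (Fin d)) :
    tensor2 a (b - b') = tensor2 a b - tensor2 a b' := by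
  ext q; simp [mul_sub]

theorem norm_tensor2 (a b : EuclideanSpace ℝ (Fin d)) : ‖tensor2 a b‖ = ‖a‖ * ‖b‖ := by
  rw [EuclideanSpace.norm_eq, EuclideanSpace.norm_eq, EuclideanSpace.norm_eq,
    ← Real.sqrt_mul (Finset.sum_nonneg fun _ _ => by positivity), Fintype.sum_prod_type,
    Finset.sum_mul_sum]
  simp [mul_pow]

theorem continuous_tensor2 : Continuous fun q : EuclideanSpace ℝ (Fin d) ×
    EuclideanSpace ℝ (Fin d) => tensor2 q.1 q.2 := by
  unfold tensor2
  refine (PiLp.continuous_toLp 2 _).comp (continuous_pi fun q => ?_)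
  fun_prop

/-- The map `A ⊗ B`, written as a combination of elementary tensors. -/
def tensorPushMixed (A B : EuclideanSpace ℝ (Fin ℓ) →L[ℝ] EuclideanSpace ℝ (Fin d))
    (M : EuclideanSpace ℝ (Fin ℓ × Fin ℓ)) : EuclideanSpace ℝ (Fin d × Fin d) :=
  ∑ k : Fin ℓ, ∑ l : Fin ℓ,
    M (k, l) • tensor2 (A (EuclideanSpace.single k 1)) (B (EuclideanSpace.single l 1))

theorem tensorPush_eq_tensorPushMixed
    (A : EuclideanSpace ℝ (Fin ℓ) →L[ℝ] EuclideanSpace ℝ (Fin d))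
    (M : EuclideanSpace ℝ (Fin ℓ × Fin ℓ)) : tensorPush A M = tensorPushMixed A A M := by
  ext q
  simp [tensorPush, tensorPushMixed, mul_comm]

theorem norm_tensorPushMixed_le
    (A B : EuclideanSpace ℝ (Fin ℓ) →L[ℝ] EuclideanSpace ℝ (Fin d))
    (M : EuclideanSpace ℝ (Fin ℓ × Fin ℓ)) :
    ‖tensorPushMixed A B M‖ ≤ (ℓ : ℝ) ^ 2 * ‖A‖ * ‖B‖ * ‖M‖ := by
  have h : ∀ k l : Fin ℓ, ‖M (k, l) • tensor2 (A (EuclideanSpace.single k 1))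
      (B (EuclideanSpace.single l 1))‖ ≤ ‖M‖ * (‖A‖ * ‖B‖) := by
    intro k l
    rw [norm_smul, norm_tensor2]
    have hA := A.le_opNorm (EuclideanSpace.single k 1)
    have hB := B.le_opNorm (EuclideanSpace.single l 1)
    rw [PiLp.norm_single, norm_one, mul_one] at hA hB
    have hM := PiLp.norm_apply_le M (k, l)
    gcongr
  calc _ ≤ ∑ _k : Fin ℓ, ∑ _l : Fin ℓ, ‖M‖ * (‖A‖ * ‖B‖) :=
        norm_sum_le_of_le _ fun k _ => norm_sum_le_of_le _ fun l _ => h k l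
    _ = _ := by
        simp only [Finset.sum_const, Finset.card_univ, Fintype.card_fin, nsmul_eq_mul]
        ring

theorem norm_tensorPush_le
    (A : EuclideanSpace ℝ (Fin ℓ) →L[ℝ] EuclideanSpace ℝ (Fin d))
    (M : EuclideanSpace ℝ (Fin ℓ × Fin ℓ)) :
    ‖tensorPush A M‖ ≤ (ℓ : ℝ) ^ 2 * ‖A‖ * ‖A‖ * ‖M‖ := by
  rw [tensorPush_eq_tensorPushMixed]
  exact norm_tensorPushMixed_le A A M

theorem norm_tensorPush_sub_le
    (A B : EuclideanSpace ℝ (Fin ℓ) →L[ℝ] EuclideanSpace ℝ (Fin d))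
    (M : EuclideanSpace ℝ (Fin ℓ × Fin ℓ)) :
    ‖tensorPush A M - tensorPush B M‖ ≤ (ℓ : ℝ) ^ 2 * ‖A - B‖ * (‖A‖ + ‖B‖) * ‖M‖ := by
  have h : tensorPush A M - tensorPush B M
      = tensorPushMixed (A - B) A M + tensorPushMixed B (A - B) M := by
    simp only [tensorPush_eq_tensorPushMixed, tensorPushMixed, sub_apply,
      tensor2_sub_left, tensor2_sub_right, smul_sub, Finset.sum_sub_distrib]
    abel
  rw [h]
  refine (norm_add_le_of_le (norm_tensorPushMixed_le _ _ _)
    (norm_tensorPushMixed_le _ _ _)).trans_eq ?_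
  ring

theorem tensorPush_add
    (A : EuclideanSpace ℝ (Fin ℓ) →L[ℝ] EuclideanSpace ℝ (Fin d))
    (M N : EuclideanSpace ℝ (Fin ℓ × Fin ℓ)) :
    tensorPush A (M + N) = tensorPush A M + tensorPush A N := by
  simp only [tensorPush_eq_tensorPushMixed, tensorPushMixed, PiLp.add_apply, add_smul,
    Finset.sum_add_distrib]

theorem euclidean_map_apply_eq_sum
    (A : EuclideanSpace ℝ (Fin ℓ) →L[ℝ] EuclideanSpace ℝ (Fin d))
    (a : EuclideanSpace ℝ (Fin ℓ)) (i : Fin d) :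
    A a i = ∑ k, a k * A (EuclideanSpace.single k 1) i := by
  have h := (EuclideanSpace.basisFun (Fin ℓ) ℝ).sum_repr a
  conv_lhs => rw [← h]
  simp

theorem tensorPush_tensor2
    (A : EuclideanSpace ℝ (Fin ℓ) →L[ℝ] EuclideanSpace ℝ (Fin d))
    (a b : EuclideanSpace ℝ (Fin ℓ)) : tensorPush A (tensor2 a b) = tensor2 (A a) (A b) := by
  ext q
  rw [tensor2_apply, euclidean_map_apply_eq_sum A a, euclidean_map_apply_eq_sum A b,
    Finset.sum_mul_sum]
  simp only [tensorPush, WithLp.equiv_symm_apply, tensor2_apply]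
  exact Finset.sum_congr rfl fun k _ => Finset.sum_congr rfl fun l _ => by ring

end Tensor

/-- **Canonical rough path above a controlled path.**  Let `2 < p < 3`, `(X, 𝕏)` a Hölder
`p`-rough path over `ℝ^ℓ` on `[0,T]` and `(z, Z')` an `ℝ^d`-valued path controlled by `X`.
There is a continuous map `ℤ`, unique with properties (i) and (ii) above, and `(Z, ℤ)` is
then a Hölder `p`-rough path over `ℝ^d`. -/
theorem controlled_path_lift
    (ℓ d : ℕ) (T p : ℝ) (hT : 0 < T) (hp1 : 2 < p) (hp2 : p < 3)
    (X : ℝ → ℝ → EuclideanSpace ℝ (Fin ℓ))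
    (XX : ℝ → ℝ → EuclideanSpace ℝ (Fin ℓ × Fin ℓ))
    (hXcont : ContinuousOn (fun q : ℝ × ℝ => X q.2 q.1)
      {q : ℝ × ℝ | 0 ≤ q.1 ∧ q.1 ≤ q.2 ∧ q.2 ≤ T})
    (hXXcont : ContinuousOn (fun q : ℝ × ℝ => XX q.2 q.1)
      {q : ℝ × ℝ | 0 ≤ q.1 ∧ q.1 ≤ q.2 ∧ q.2 ≤ T})
    (hChen : ∀ s u t : ℝ, 0 ≤ s → s ≤ u → u ≤ t → t ≤ T →
      X t s = X t u + X u s ∧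
      ∀ q : Fin ℓ × Fin ℓ, XX t s q = XX t u q + XX u s q + X u s q.1 * X t u q.2)
    (CX : ℝ)
    (hX : ∀ s t : ℝ, 0 ≤ s → s ≤ t → t ≤ T →
      ‖X t s‖ ≤ CX * (t - s) ^ (1 / p) ∧ ‖XX t s‖ ≤ CX * (t - s) ^ (2 / p))
    (z : ℝ → EuclideanSpace ℝ (Fin d))
    (Z' : ℝ → EuclideanSpace ℝ (Fin ℓ) →L[ℝ] EuclideanSpace ℝ (Fin d))
    (C1 C2 : ℝ)
    (hZ' : ∀ s t : ℝ, 0 ≤ s → s ≤ t → t ≤ T → ‖Z' t - Z' s‖ ≤ C1 * (t - s) ^ (1 / p))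
    (hR : ∀ s t : ℝ, 0 ≤ s → s ≤ t → t ≤ T →
      ‖z t - z s - Z' s (X t s)‖ ≤ C2 * (t - s) ^ (2 / p)) :
    ∃ ZZ : ℝ → ℝ → EuclideanSpace ℝ (Fin d × Fin d),
      ContinuousOn (fun q : ℝ × ℝ => ZZ q.2 q.1)
        {q : ℝ × ℝ | 0 ≤ q.1 ∧ q.1 ≤ q.2 ∧ q.2 ≤ T} ∧
      IsLift ℓ d T p XX z Z' ZZ ∧
      (∀ ZZ' : ℝ → ℝ → EuclideanSpace ℝ (Fin d × Fin d), IsLift ℓ d T p XX z Z' ZZ' →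
        ∀ s t : ℝ, 0 ≤ s → s ≤ t → t ≤ T → ZZ' t s = ZZ t s) ∧
      (∃ K : ℝ, ∀ s t : ℝ, 0 ≤ s → s ≤ t → t ≤ T →
        ‖z t - z s‖ ≤ K * (t - s) ^ (1 / p) ∧ ‖ZZ t s‖ ≤ K * (t - s) ^ (2 / p)) := by
  have hp0 : 0 < p := by linarith
  have hr : 0 < 1 / p := by positivity
  have hθ : 1 < 3 / p := by rwa [one_lt_div hp0]
  have pow2 : ∀ x : ℝ, 0 ≤ x → x ^ (2 / p) = (x ^ (1 / p)) ^ 2 := fun x hx => by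
    rw [← Real.rpow_natCast, ← Real.rpow_mul hx]; congr 1; push_cast; ring
  have pow3 : ∀ x : ℝ, 0 ≤ x → x ^ (3 / p) = (x ^ (1 / p)) ^ 3 := fun x hx => by
    rw [← Real.rpow_natCast, ← Real.rpow_mul hx]; congr 1; push_cast; ring
  have const_nonneg : ∀ (K r : ℝ), 0 ≤ K * (T - 0) ^ r → 0 ≤ K := fun K r h =>
    nonneg_of_mul_nonneg_left h (Real.rpow_pos_of_pos (by linarith) r)
  have hCX0 := const_nonneg _ _ ((norm_nonneg _).trans (hX 0 T le_rfl hT.le le_rfl).1)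
  have hC10 := const_nonneg _ _ ((norm_nonneg _).trans (hZ' 0 T le_rfl hT.le le_rfl))
  have hC20 := const_nonneg _ _ ((norm_nonneg _).trans (hR 0 T le_rfl hT.le le_rfl))
  obtain ⟨H, hH⟩ : ∃ H, H = T ^ (1 / p) := ⟨_, rfl⟩
  have hH0 : 0 ≤ H := hH ▸ Real.rpow_nonneg hT.le _
  have hle : ∀ s t : ℝ, 0 ≤ s → s ≤ t → t ≤ T → (t - s) ^ (1 / p) ≤ H := fun s t hs hst ht =>
    hH ▸ Real.rpow_le_rpow (by linarith) (by linarith) hr.le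
  have hpos : ∀ s t : ℝ, s ≤ t → 0 ≤ (t - s) ^ (1 / p) := fun s t hst =>
    Real.rpow_nonneg (by linarith) _
  obtain ⟨M, hM⟩ : ∃ M, M = ‖Z' 0‖ + C1 * H := ⟨_, rfl⟩
  have hM0 : 0 ≤ M := by rw [hM]; positivity
  have hZ'M : ∀ s, 0 ≤ s → s ≤ T → ‖Z' s‖ ≤ M := by
    intro s hs hsT
    have h1 := hZ' 0 s le_rfl hs hsT
    have h2 := hle 0 s le_rfl hs hsT
    calc ‖Z' s‖ ≤ ‖Z' 0‖ + ‖Z' s - Z' 0‖ := norm_le_insert' _ _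
      _ ≤ ‖Z' 0‖ + C1 * H := by
        gcongr
        exact h1.trans (by gcongr)
      _ = M := hM.symm
  obtain ⟨B, hB⟩ : ∃ B, B = M * CX + C2 * H := ⟨_, rfl⟩
  have hB0 : 0 ≤ B := by rw [hB]; positivity
  have hZX : ∀ s u t, 0 ≤ s → s ≤ T → 0 ≤ u → u ≤ t → t ≤ T →
      ‖Z' s (X t u)‖ ≤ M * (CX * (t - u) ^ (1 / p)) := by
    intro s u t hs hsT hu hut htT
    refine ((Z' s).le_opNorm _).trans ?_
    have h1 := hZ'M s hs hsT
    have h2 := (hX u t hu hut htT).1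
    gcongr
  have hz : ∀ s t, 0 ≤ s → s ≤ t → t ≤ T → ‖z t - z s‖ ≤ B * (t - s) ^ (1 / p) := by
    intro s t hs hst htT
    have h1 := hR s t hs hst htT
    have h2 := hZX s s t hs (hst.trans htT) hs hst htT
    have h3 := hle s t hs hst htT
    have h4 := hpos s t hst
    rw [pow2 _ (by linarith)] at h1
    generalize (t - s) ^ (1 / p) = h at *
    calc ‖z t - z s‖ ≤ ‖Z' s (X t s)‖ + ‖z t - z s - Z' s (X t s)‖ := norm_le_insert' _ _
      _ ≤ M * (CX * h) + C2 * (H * h) := by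
        gcongr
        exact h1.trans (by rw [sq]; gcongr)
      _ = B * h := by rw [hB]; ring
  have hpush : ∀ s t, 0 ≤ s → s ≤ t → t ≤ T →
      ‖tensorPush (Z' s) (XX t s)‖ ≤ (ℓ : ℝ) ^ 2 * M * M * CX * (t - s) ^ (2 / p) := by
    intro s t hs hst htT
    have h1 := hZ'M s hs (hst.trans htT)
    have h2 := (hX s t hs hst htT).2
    refine (norm_tensorPush_le _ _).trans ?_
    calc _ ≤ (ℓ : ℝ) ^ 2 * M * M * (CX * (t - s) ^ (2 / p)) := by gcongr
      _ = _ := by ring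
  obtain ⟨Ξ, hΞ⟩ : ∃ Ξ : ℝ → ℝ → EuclideanSpace ℝ (Fin d × Fin d),
      ∀ s t, Ξ s t = tensorPush (Z' s) (XX t s) + tensor2 (z s) (z t - z s) :=
    ⟨_, fun _ _ => rfl⟩
  obtain ⟨C, hC⟩ : ∃ C, C = (ℓ : ℝ) ^ 2 * C1 * (M + M) * CX + C2 * (M * CX)
      + B * (C1 * CX + C2) := ⟨_, rfl⟩
  have hC0 : 0 ≤ C := by rw [hC]; positivity
  have hdef : ∀ s u t, 0 ≤ s → s ≤ u → u ≤ t → t ≤ T →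
      ‖Ξ s t - Ξ s u - Ξ u t‖ ≤ C * (t - s) ^ (3 / p) := by
    intro s u t hs hsu hut htT
    have hu := hs.trans hsu
    have huT := hut.trans htT
    have hsT := hsu.trans huT
    have hXXeq : XX t s = XX t u + XX u s + tensor2 (X u s) (X t u) := by
      ext q
      simpa using (hChen s u t hs hsu hut htT).2 q
    have e : Ξ s t - Ξ s u - Ξ u t
        = (tensorPush (Z' s) (XX t u) - tensorPush (Z' u) (XX t u))
          - tensor2 (z u - z s - Z' s (X u s)) (Z' s (X t u))
          + tensor2 (z u - z s) ((Z' s - Z' u) (X t u) - (z t - z u - Z' u (X t u))) := by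
      simp only [hΞ, hXXeq, tensorPush_add, tensorPush_tensor2]
      ext q
      simp only [PiLp.add_apply, PiLp.sub_apply, tensor2_apply, sub_apply]
      ring
    have mono1 : (u - s) ^ (1 / p) ≤ (t - s) ^ (1 / p) :=
      Real.rpow_le_rpow (by linarith) (by linarith) hr.le
    have mono2 : (t - u) ^ (1 / p) ≤ (t - s) ^ (1 / p) :=
      Real.rpow_le_rpow (by linarith) (by linarith) hr.le
    have p1 := hpos s u hsu
    have p2 := hpos u t hut
    have bZ := hZ' s u hs hsu huT
    rw [norm_sub_rev] at bZ
    have bX := (hX u t hu hut htT).1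
    have bXX := (hX u t hu hut htT).2
    have bR1 := hR s u hs hsu huT
    have bR2 := hR u t hu hut htT
    have bz := hz s u hs hsu huT
    have bZX := hZX s u t hs hsT hu hut htT
    have bs := hZ'M s hs hsT
    have bu := hZ'M u hu huT
    rw [pow2 _ (by linarith)] at bXX bR1 bR2
    rw [e, pow3 _ (by linarith)]
    generalize (u - s) ^ (1 / p) = h1 at *
    generalize (t - u) ^ (1 / p) = h2 at *
    generalize (t - s) ^ (1 / p) = h at *
    have p3 : 0 ≤ h := p1.trans mono1
    have t1 : ‖tensorPush (Z' s) (XX t u) - tensorPush (Z' u) (XX t u)‖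
        ≤ (ℓ : ℝ) ^ 2 * (C1 * h) * (M + M) * (CX * h ^ 2) := by
      refine (norm_tensorPush_sub_le _ _ _).trans ?_
      have a1 : ‖Z' s - Z' u‖ ≤ C1 * h := bZ.trans (by gcongr)
      have a2 : ‖XX t u‖ ≤ CX * h ^ 2 := bXX.trans (by gcongr)
      gcongr
    have t2 : ‖tensor2 (z u - z s - Z' s (X u s)) (Z' s (X t u))‖
        ≤ (C2 * h ^ 2) * (M * (CX * h)) := by
      rw [norm_tensor2]
      have a1 := bR1.trans (show C2 * h1 ^ 2 ≤ C2 * h ^ 2 by gcongr)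
      have a2 := bZX.trans (show M * (CX * h2) ≤ M * (CX * h) by gcongr)
      gcongr
    have t3 : ‖tensor2 (z u - z s) ((Z' s - Z' u) (X t u) - (z t - z u - Z' u (X t u)))‖
        ≤ (B * h) * ((C1 * h) * (CX * h) + C2 * h ^ 2) := by
      rw [norm_tensor2]
      have a1 := bz.trans (show B * h1 ≤ B * h by gcongr)
      have a2 : ‖(Z' s - Z' u) (X t u)‖ ≤ (C1 * h) * (CX * h) := by
        refine ((Z' s - Z' u).le_opNorm _).trans ?_
        have b1 := bZ.trans (show C1 * h1 ≤ C1 * h by gcongr)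
        have b2 := bX.trans (show CX * h2 ≤ CX * h by gcongr)
        gcongr
      have a3 := norm_sub_le_of_le a2 (bR2.trans (show C2 * h2 ^ 2 ≤ C2 * h ^ 2 by gcongr))
      gcongr
    refine (norm_add_le_of_le (norm_sub_le_of_le t1 t2) t3).trans_eq ?_
    rw [hC]
    ring
  obtain ⟨I, hI⟩ := exists_sewing hC0 hθ hdef
  have hK0 := sewingConst_nonneg hC0 hθ
  generalize sewingConst C (3 / p) = K at *
  obtain ⟨ZZ, hZZ⟩ : ∃ ZZ : ℝ → ℝ → EuclideanSpace ℝ (Fin d × Fin d),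
      ∀ t s, ZZ t s = I t - I s - tensor2 (z s) (z t - z s) := ⟨_, fun _ _ => rfl⟩
  have hloc : ∀ s t, 0 ≤ s → s ≤ t → t ≤ T →
      ‖ZZ t s - tensorPush (Z' s) (XX t s)‖ ≤ K * (t - s) ^ (3 / p) := by
    intro s t hs hst htT
    have := hI s t hs hst htT
    rwa [hΞ, add_comm, ← sub_sub, ← hZZ] at this
  have hchen : ∀ s u t : ℝ, 0 ≤ s → s ≤ u → u ≤ t → t ≤ T →
      ZZ t s = ZZ t u + ZZ u s + tensor2 (z u - z s) (z t - z u) := by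
    intro s u t _ _ _ _
    simp only [hZZ]
    ext q
    simp only [PiLp.add_apply, PiLp.sub_apply, tensor2_apply]
    ring
  obtain ⟨L, hL⟩ : ∃ L, L = (ℓ : ℝ) ^ 2 * M * M * CX + K * H := ⟨_, rfl⟩
  have hL0 : 0 ≤ L := by rw [hL]; positivity
  have hZZbd : ∀ s t, 0 ≤ s → s ≤ t → t ≤ T → ‖ZZ t s‖ ≤ L * (t - s) ^ (2 / p) := by
    intro s t hs hst htT
    have h1 := hloc s t hs hst htT
    have h2 := hpush s t hs hst htT
    have h3 := hle s t hs hst htT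
    have h4 := hpos s t hst
    rw [pow3 _ (by linarith)] at h1
    rw [pow2 _ (by linarith)] at h2 ⊢
    generalize (t - s) ^ (1 / p) = h at *
    calc ‖ZZ t s‖ ≤ ‖tensorPush (Z' s) (XX t s)‖ + ‖ZZ t s - tensorPush (Z' s) (XX t s)‖ :=
          norm_le_insert' _ _
      _ ≤ (ℓ : ℝ) ^ 2 * M * M * CX * h ^ 2 + K * (H * h ^ 2) := by
        gcongr
        exact h1.trans (by rw [pow_succ' h 2]; gcongr)
      _ = L * h ^ 2 := by rw [hL]; ring
  have hIcont : ContinuousOn I (Set.Icc 0 T) := by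
    refine continuousOn_Icc_of_norm_sub_le_rpow
      (K := L * H + (‖z 0‖ + B * H) * B) hr fun s t hs hst htT => ?_
    have h1 := hZZbd s t hs hst htT
    have h2 := hz s t hs hst htT
    have h3 := hle s t hs hst htT
    have h4 := hpos s t hst
    have h5 : ‖z s‖ ≤ ‖z 0‖ + B * H := by
      refine (norm_le_insert' (z s) (z 0)).trans ?_
      have a1 := hz 0 s le_rfl hs (hst.trans htT)
      have a2 := hle 0 s le_rfl hs (hst.trans htT)
      gcongr
      exact a1.trans (by gcongr)
    rw [pow2 _ (by linarith)] at h1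
    generalize (t - s) ^ (1 / p) = h at *
    calc ‖I t - I s‖ = ‖ZZ t s + tensor2 (z s) (z t - z s)‖ := by rw [hZZ]; congr 1; abel
      _ ≤ L * h ^ 2 + (‖z 0‖ + B * H) * (B * h) := by
        refine norm_add_le_of_le h1 ?_
        rw [norm_tensor2]
        gcongr
      _ ≤ L * (H * h) + (‖z 0‖ + B * H) * (B * h) := by rw [sq]; gcongr
      _ = _ := by ring
  have hzcont := continuousOn_Icc_of_norm_sub_le_rpow hr hz
  refine ⟨ZZ, ?_, ⟨hchen, K + 1, by linarith, ?_⟩, ?_, max B L, ?_⟩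
  · have m1 : Set.MapsTo (fun q : ℝ × ℝ => q.1)
        {q : ℝ × ℝ | 0 ≤ q.1 ∧ q.1 ≤ q.2 ∧ q.2 ≤ T} (Set.Icc 0 T) :=
      fun q hq => ⟨hq.1, hq.2.1.trans hq.2.2⟩
    have m2 : Set.MapsTo (fun q : ℝ × ℝ => q.2)
        {q : ℝ × ℝ | 0 ≤ q.1 ∧ q.1 ≤ q.2 ∧ q.2 ≤ T} (Set.Icc 0 T) :=
      fun q hq => ⟨hq.1.trans hq.2.1, hq.2.2⟩
    have z1 := hzcont.comp continuous_fst.continuousOn m1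
    have z2 := hzcont.comp continuous_snd.continuousOn m2
    simp only [hZZ]
    exact ((hIcont.comp continuous_snd.continuousOn m2).sub
      (hIcont.comp continuous_fst.continuousOn m1)).sub
      (continuous_tensor2.comp_continuousOn (z1.prodMk (z2.sub z1)))
  · intro s t hs hst htT
    refine (hloc s t hs hst htT).trans ?_
    have : 0 ≤ (t - s) ^ (3 / p) := Real.rpow_nonneg (by linarith) _
    gcongr
    linarith
  · rintro ZZ' ⟨hchen', c, -, hloc'⟩ s t hs hst htT
    refine sub_eq_zero.mp (eq_zero_of_additive_of_norm_le (T := T) (c := c + K) hθ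
      (D := fun s t => ZZ' t s - ZZ t s) ?_ ?_ hs hst htT)
    · intro s u t hs hsu hut htT
      simp only [hchen' s u t hs hsu hut htT, hchen s u t hs hsu hut htT]
      abel
    · intro s t hs hst htT
      rw [← sub_sub_sub_cancel_right _ _ (tensorPush (Z' s) (XX t s)), add_mul]
      exact norm_sub_le_of_le (hloc' s t hs hst htT) (hloc s t hs hst htT)
  · intro s t hs hst htT
    have a1 := hpos s t hst
    have a2 : 0 ≤ (t - s) ^ (2 / p) := Real.rpow_nonneg (by linarith) _
    exact ⟨(hz s t hs hst htT).trans (by gcongr; exact le_max_left _ _),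
      (hZZbd s t hs hst htT).trans (by gcongr; exact le_max_right _ _)⟩
end
end

section
/- (Rough integral.) Let 2<p<3 and let (X,𝕏) be a Hölder p-rough path over ℝ^ℓ on [0,T]. Let F : [0,T] → L(ℝ^ℓ,ℝ^n) be a path controlled by X with derivative F' : [0,T] → L(ℝ^ℓ, L(ℝ^ℓ,ℝ^n)) (so F' is (1/p)-Hölder and |F_t − F_s − F'_s X_{ts}| ≤ C|t−s|^{2/p} for some C). Then the map μ_{ts} := F_s X_{ts} + F'_s 𝕏_{ts} (where F'_s is viewed as a linear map ℝ^ℓ⊗ℝ^ℓ → ℝ^n) is almost additive: there is a constant c>0 with |(μ_{tu} + μ_{us}) − μ_{ts}| ≤ c|t−s|^{3/p} for all 0≤s≤u≤t≤T. Consequently there exists a unique path I : [0,T] → ℝ^n with I₀ = 0 such that, for some constant c'>0, |I_t − I_s − F_s X_{ts} − F'_s 𝕏_{ts}| ≤ c'|t−s|^{3/p} for all 0≤s≤t≤T (the rough integral ∫ F dX). -/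
/-!
Statement 12: the rough integral of a controlled path against a rough path.
-/

noncomputable section

/-- The germ `μ_{ts} = F_s X_{ts} + F'_s 𝕏_{ts}` of the rough integral, where the
derivative `F'_s : ℝ^ℓ → L(ℝ^ℓ, ℝ^n)` is viewed as a linear map `ℝ^ℓ ⊗ ℝ^ℓ → ℝ^n`
through its values on the canonical basis. -/
def sewGerm {ℓ n : ℕ}
    (F : ℝ → EuclideanSpace ℝ (Fin ℓ) →L[ℝ] EuclideanSpace ℝ (Fin n))
    (F' : ℝ → EuclideanSpace ℝ (Fin ℓ) →L[ℝ]
      (EuclideanSpace ℝ (Fin ℓ) →L[ℝ] EuclideanSpace ℝ (Fin n)))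
    (X : ℝ → ℝ → EuclideanSpace ℝ (Fin ℓ))
    (XX : ℝ → ℝ → EuclideanSpace ℝ (Fin ℓ × Fin ℓ))
    (t s : ℝ) : EuclideanSpace ℝ (Fin n) :=
  F s (X t s) + ∑ k : Fin ℓ, ∑ l : Fin ℓ,
    XX t s (k, l) • F' s (EuclideanSpace.single k 1) (EuclideanSpace.single l 1)

section

open Filter Topology

/-- A path on `[0, T]` that is Hölder of exponent greater than one is constant. -/
theorem eq_of_norm_sub_le_rpow_s12 {E : Type*} [NormedAddCommGroup E] {D : ℝ → E} {T a C : ℝ}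
    (ha : 1 < a)
    (hD : ∀ s t : ℝ, 0 ≤ s → s ≤ t → t ≤ T → ‖D t - D s‖ ≤ C * (t - s) ^ a)
    {t : ℝ} (ht0 : 0 ≤ t) (htT : t ≤ T) : D t = D 0 := by
  have key : ∀ m : ℕ, ‖D t - D 0‖ ≤ C * t ^ a * ((m + 1 : ℕ) : ℝ) ^ (-(a - 1)) := by
    intro m
    set N : ℕ := m + 1
    have hN0 : (0 : ℝ) < N := by positivity
    have hsum : D t - D 0 = ∑ k ∈ Finset.range N,
        (D ((k + 1 : ℕ) * (t / N)) - D (k * (t / N))) := by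
      rw [Finset.sum_range_sub (fun k : ℕ => D (k * (t / N)))]
      simp [mul_div_cancel₀ _ hN0.ne']
    have hterm : ∀ k ∈ Finset.range N,
        ‖D ((k + 1 : ℕ) * (t / N)) - D (k * (t / N))‖ ≤ C * (t / N) ^ a := by
      intro k hk
      have hk' : ((k + 1 : ℕ) : ℝ) ≤ N := by exact_mod_cast Finset.mem_range.1 hk
      have hh : 0 ≤ t / N := by positivity
      refine (hD _ _ (by positivity) (by push_cast; nlinarith) ?_).trans_eq ?_
      · calc ((k + 1 : ℕ) : ℝ) * (t / N) ≤ N * (t / N) := by gcongr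
          _ = t := mul_div_cancel₀ _ hN0.ne'
          _ ≤ T := htT
      · push_cast
        congr 2
        ring
    rw [hsum]
    refine (norm_sum_le_of_le _ hterm).trans_eq ?_
    rw [Finset.sum_const, Finset.card_range, nsmul_eq_mul, Real.div_rpow ht0 hN0.le, neg_sub,
      Real.rpow_sub hN0, Real.rpow_one]
    ring
  have hlim : Tendsto (fun m : ℕ => C * t ^ a * ((m + 1 : ℕ) : ℝ) ^ (-(a - 1))) atTop (𝓝 0) := by
    have h := (tendsto_rpow_neg_atTop (sub_pos.2 ha)).comp
      (tendsto_natCast_atTop_atTop.comp (tendsto_add_atTop_nat 1))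
    simpa using h.const_mul (C * t ^ a)
  exact sub_eq_zero.1 (norm_le_zero_iff.1 (ge_of_tendsto' hlim key))

section Sewing

variable {E : Type*} [NormedAddCommGroup E] {μ : ℝ → ℝ → E} {T a c : ℝ}

theorem germ_self_eq_zero_s12 (ha : 1 < a)
    (hμ : ∀ s u t : ℝ, 0 ≤ s → s ≤ u → u ≤ t → t ≤ T →
      ‖μ t u + μ u s - μ t s‖ ≤ c * (t - s) ^ a)
    {s : ℝ} (hs0 : 0 ≤ s) (hsT : s ≤ T) : μ s s = 0 := by
  have h := hμ s s s hs0 le_rfl le_rfl hsT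
  rw [sub_self, Real.zero_rpow (by linarith), mul_zero, add_sub_cancel_right] at h
  exact norm_le_zero_iff.1 h

/-- Maximal inequality: Riemann sums of an almost additive germ over arbitrary partitions are
uniformly close to the germ. The proof splits a partition at the cell containing the midpoint. -/
theorem norm_sum_germ_sub_le_s12 (ha : 1 < a) (hc : 0 ≤ c)
    (hμ : ∀ s u t : ℝ, 0 ≤ s → s ≤ u → u ≤ t → t ≤ T →
      ‖μ t u + μ u s - μ t s‖ ≤ c * (t - s) ^ a)
    {x : ℕ → ℝ} (hx : Monotone x) {i j : ℕ} (hij : i ≤ j) (hi : 0 ≤ x i) (hj : x j ≤ T) :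
    ‖∑ k ∈ Finset.Ico i j, μ (x (k + 1)) (x k) - μ (x j) (x i)‖ ≤
      2 * c / (1 - 2 ^ (1 - a)) * (x j - x i) ^ a := by
  have h2 : (2 : ℝ) ^ (1 - a) < 1 := Real.rpow_lt_one_of_one_lt_of_neg one_lt_two (by linarith)
  set K := 2 * c / (1 - 2 ^ (1 - a)) with hK
  have hK0 : 0 ≤ K := div_nonneg (by positivity) (by linarith)
  have hKeq : K * 2 ^ (1 - a) + 2 * c = K := by
    have : (1 - (2 : ℝ) ^ (1 - a)) ≠ 0 := by linarith
    rw [hK]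
    field_simp
    ring
  induction hd : j - i using Nat.strong_induction_on generalizing i j with
  | _ d ih =>
  rcases hij.eq_or_lt with rfl | hlt
  · simp [germ_self_eq_zero_s12 ha hμ hi hj, Real.zero_rpow (by linarith : a ≠ 0)]
  · have hxij := hx hij
    set m := (x i + x j) / 2 with hm
    obtain ⟨k, hik, hkj, hkm, hmk⟩ :
        ∃ k, i ≤ k ∧ k < j ∧ x k ≤ m ∧ m ≤ x (k + 1) := by
      have hex : ∃ k, i ≤ k ∧ m ≤ x (k + 1) :=
        ⟨j - 1, by omega, by rw [Nat.sub_add_cancel (by omega)]; linarith⟩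
      classical
      obtain ⟨h1, h2⟩ := Nat.find_spec hex
      refine ⟨Nat.find hex, h1, ?_, ?_, h2⟩
      · have : Nat.find hex ≤ j - 1 :=
          Nat.find_min' hex ⟨by omega, by rw [Nat.sub_add_cancel (by omega)]; linarith⟩
        omega
      · rcases h1.eq_or_lt with h | h
        · rw [← h]; linarith
        · by_contra! hcon
          exact Nat.find_min hex (m := Nat.find hex - 1) (by omega)
            ⟨by omega, by rw [Nat.sub_add_cancel (by omega)]; exact hcon.le⟩
    have hx1 := hx hik
    have hx2 := hx (Nat.le_add_right k 1)
    have hx3 := hx (Nat.succ_le_of_lt hkj)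
    rw [Nat.succ_eq_add_one] at hx3
    have hhalf : ∀ y, 0 ≤ y → y ≤ (x j - x i) / 2 →
        K * y ^ a ≤ K * 2 ^ (1 - a) * (x j - x i) ^ a / 2 := by
      intro y hy0 hy
      calc K * y ^ a ≤ K * ((x j - x i) / 2) ^ a := by gcongr
        _ = _ := by
          rw [Real.div_rpow (by linarith) (by norm_num), Real.rpow_sub two_pos, Real.rpow_one]
          field_simp
    have hA := (ih (k - i) (by omega) hik hi (by linarith) rfl).trans
      (hhalf _ (by linarith) (by linarith))
    have hB := (ih (j - (k + 1)) (by omega) hkj (by linarith) hj rfl).trans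
      (hhalf _ (by linarith) (by linarith))
    have hC := hμ (x i) (x k) (x (k + 1)) hi hx1 hx2 (by linarith)
    have hC' : c * (x (k + 1) - x i) ^ a ≤ c * (x j - x i) ^ a := by
      have : 0 ≤ x (k + 1) - x i := by linarith
      gcongr
    have hD := hμ (x i) (x (k + 1)) (x j) hi (by linarith) hx3 hj
    rw [← Finset.sum_Ico_consecutive _ hik hkj.le, Finset.sum_eq_sum_Ico_succ_bot hkj]
    set S1 := ∑ k ∈ Finset.Ico i k, μ (x (k + 1)) (x k)
    set S2 := ∑ k ∈ Finset.Ico (k + 1) j, μ (x (k + 1)) (x k)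
    calc _ = ‖(S1 - μ (x k) (x i)) + (S2 - μ (x j) (x (k + 1)))
          + (μ (x (k + 1)) (x k) + μ (x k) (x i) - μ (x (k + 1)) (x i))
          + (μ (x j) (x (k + 1)) + μ (x (k + 1)) (x i) - μ (x j) (x i))‖ := by
            congr 1; abel
      _ ≤ _ := norm_add₄_le
      _ ≤ (K * 2 ^ (1 - a) + 2 * c) * (x j - x i) ^ a := by linarith
      _ = K * (x j - x i) ^ a := by rw [hKeq]

/-- The Riemann sum of `μ` over `[0, t]` along the grid of mesh `h`, including the last,
incomplete cell. -/
noncomputable def germRiemannSum (μ : ℝ → ℝ → E) (h t : ℝ) : E :=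
  ∑ k ∈ Finset.range ⌊t / h⌋₊, μ ((k + 1 : ℕ) * h) (k * h) + μ t (⌊t / h⌋₊ * h)

theorem norm_germRiemannSum_sub_le (ha : 1 < a) (hc : 0 ≤ c)
    (hμ : ∀ s u t : ℝ, 0 ≤ s → s ≤ u → u ≤ t → t ≤ T →
      ‖μ t u + μ u s - μ t s‖ ≤ c * (t - s) ^ a)
    {h : ℝ} (hh : 0 < h) {s t : ℝ} (hs : 0 ≤ s) (hst : s ≤ t) (ht : t ≤ T) :
    ‖germRiemannSum μ h t - germRiemannSum μ h s - μ t s‖ ≤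
      (2 * c / (1 - 2 ^ (1 - a)) + 2 * c) * (t - s + h) ^ a := by
  have h2 : (2 : ℝ) ^ (1 - a) < 1 := Real.rpow_lt_one_of_one_lt_of_neg one_lt_two (by linarith)
  have hij : ⌊s / h⌋₊ ≤ ⌊t / h⌋₊ := Nat.floor_mono (by gcongr)
  have hjt : ⌊t / h⌋₊ * h ≤ t :=
    (le_div_iff₀ hh).1 (Nat.floor_le (div_nonneg (hs.trans hst) hh.le))
  have his : ⌊s / h⌋₊ * h ≤ s := (le_div_iff₀ hh).1 (Nat.floor_le (div_nonneg hs hh.le))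
  have hsi : s ≤ ⌊s / h⌋₊ * h + h := by
    have := (div_lt_iff₀ hh).1 (Nat.lt_floor_add_one (s / h))
    linarith
  unfold germRiemannSum
  set i := ⌊s / h⌋₊
  set j := ⌊t / h⌋₊
  have hi0 : 0 ≤ i * h := by positivity
  have hmono : Monotone fun k : ℕ => (k : ℝ) * h := fun k l hkl => by
    have : (k : ℝ) ≤ l := by exact_mod_cast hkl
    dsimp only
    gcongr
  have hA := norm_sum_germ_sub_le_s12 ha hc hμ hmono hij hi0 (hjt.trans ht)
  have hxij : (i : ℝ) * h ≤ j * h := hmono hij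
  have hB := hμ (i * h) (j * h) t hi0 hxij hjt ht
  have hC := hμ (i * h) s t hi0 his hst ht
  rw [← Finset.sum_range_add_sum_Ico _ hij]
  set K := 2 * c / (1 - 2 ^ (1 - a))
  have hK0 : 0 ≤ K := div_nonneg (by positivity) (by linarith)
  set S0 := ∑ k ∈ Finset.range i, μ ((k + 1 : ℕ) * h) (k * h)
  set S1 := ∑ k ∈ Finset.Ico i j, μ ((k + 1 : ℕ) * h) (k * h)
  have hA' : K * (j * h - i * h) ^ a ≤ K * (t - s + h) ^ a := by
    have : 0 ≤ j * h - i * h := by linarith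
    gcongr
    linarith
  have hBC : c * (t - i * h) ^ a ≤ c * (t - s + h) ^ a := by
    have : 0 ≤ t - i * h := by linarith
    gcongr
    linarith
  calc _ = ‖(S1 - μ (j * h) (i * h)) + (μ t (j * h) + μ (j * h) (i * h) - μ t (i * h))
        - (μ t s + μ s (i * h) - μ t (i * h))‖ := by congr 1; abel
    _ ≤ _ := (norm_sub_le _ _).trans (add_le_add_left (norm_add_le _ _) _)
    _ ≤ _ := by linarith

/-- **Sewing lemma**: an almost additive germ of exponent `a > 1` is approximated to order `a` by
the increments of a path. -/
theorem exists_sewing_s12 [ProperSpace E] (ha : 1 < a) (hc : 0 ≤ c)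
    (hμ : ∀ s u t : ℝ, 0 ≤ s → s ≤ u → u ≤ t → t ≤ T →
      ‖μ t u + μ u s - μ t s‖ ≤ c * (t - s) ^ a) :
    ∃ I : ℝ → E, I 0 = 0 ∧ ∃ c' : ℝ, ∀ s t : ℝ, 0 ≤ s → s ≤ t → t ≤ T →
      ‖I t - I s - μ t s‖ ≤ c' * (t - s) ^ a := by
  rcases lt_or_ge T 0 with hT | hT
  · exact ⟨0, rfl, 0, fun s t h1 h2 h3 => by linarith⟩
  have h2 : (2 : ℝ) ^ (1 - a) < 1 := Real.rpow_lt_one_of_one_lt_of_neg one_lt_two (by linarith)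
  set K := 2 * c / (1 - 2 ^ (1 - a)) + 2 * c
  have hK0 : 0 ≤ K := add_nonneg (div_nonneg (by positivity) (by linarith)) (by positivity)
  let h : ℕ → ℝ := fun m => 1 / ((m : ℝ) + 1)
  have hpos : ∀ m, 0 < h m := fun m => by positivity
  have hle : ∀ m, h m ≤ 1 := fun m => by
    simp only [h]
    rw [div_le_one (by positivity)]
    simp
  have hS0 : ∀ m, germRiemannSum μ (h m) 0 = 0 := fun m => by
    simp [germRiemannSum, germ_self_eq_zero_s12 ha hμ le_rfl hT]
  have hlim : ∀ t, 0 ≤ t → t ≤ T → ∃ y,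
      Tendsto (fun m => germRiemannSum μ (h m) t) (hyperfilter ℕ : Filter ℕ) (𝓝 y) := by
    intro t ht0 htT
    have hmem : ∀ m, germRiemannSum μ (h m) t ∈ Metric.closedBall (μ t 0) (K * (t + 1) ^ a) := by
      intro m
      have hb := norm_germRiemannSum_sub_le ha hc hμ (hpos m) le_rfl ht0 htT
      rw [hS0, sub_zero, sub_zero] at hb
      rw [mem_closedBall_iff_norm]
      refine hb.trans ?_
      have := hpos m
      gcongr
      exact hle m
    obtain ⟨y, -, hy⟩ := (isCompact_closedBall (μ t 0) (K * (t + 1) ^ a)).ultrafilter_le_nhds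
      ((hyperfilter ℕ).map fun m => germRiemannSum μ (h m) t)
      (le_principal_iff.2 (Ultrafilter.mem_map.2 (univ_mem' hmem)))
    exact ⟨y, hy⟩
  choose! I hI using hlim
  refine ⟨I, ?_, K, fun s t hs hst ht => ?_⟩
  · refine tendsto_nhds_unique (hI 0 le_rfl hT) ?_
    simp [hS0]
  · have hleft := (((hI t (hs.trans hst) ht).sub (hI s hs (hst.trans ht))).sub_const (μ t s)).norm
    have hmesh : Tendsto h (hyperfilter ℕ : Filter ℕ) (𝓝 0) :=
      tendsto_one_div_add_atTop_nhds_zero_nat.mono_left Nat.hyperfilter_le_atTop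
    have hright : Tendsto (fun m => K * (t - s + h m) ^ a) (hyperfilter ℕ : Filter ℕ)
        (𝓝 (K * (t - s + 0) ^ a)) :=
      ((hmesh.const_add _).rpow_const (Or.inr (by linarith))).const_mul K
    rw [add_zero] at hright
    exact le_of_tendsto_of_tendsto' hleft hright fun m =>
      norm_germRiemannSum_sub_le ha hc hμ (hpos m) hs hst ht

end Sewing

end

theorem norm_sum_smul_apply_single_le {ι G : Type*} [Fintype ι] [DecidableEq ι]
    [NormedAddCommGroup G] [NormedSpace ℝ G] (w : EuclideanSpace ℝ (ι × ι))
    (A : EuclideanSpace ℝ ι →L[ℝ] EuclideanSpace ℝ ι →L[ℝ] G) :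
    ‖∑ k, ∑ l, w (k, l) • A (EuclideanSpace.single k 1) (EuclideanSpace.single l 1)‖ ≤
      (Fintype.card ι : ℝ) ^ 2 * (‖w‖ * ‖A‖) := by
  have hterm : ∀ k l, ‖w (k, l) • A (EuclideanSpace.single k 1) (EuclideanSpace.single l 1)‖ ≤
      ‖w‖ * ‖A‖ := fun k l => by
    rw [norm_smul]
    gcongr
    · exact PiLp.norm_apply_le w (k, l)
    · simpa using A.le_opNorm₂ (EuclideanSpace.single k 1) (EuclideanSpace.single l 1)
  refine (norm_sum_le_of_le _ fun k _ => norm_sum_le_of_le _ fun l _ => hterm k l).trans_eq ?_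
  simp only [Finset.sum_const, Finset.card_univ, nsmul_eq_mul]
  ring

theorem sum_mul_smul_apply_single {ι G : Type*} [Fintype ι] [DecidableEq ι]
    [NormedAddCommGroup G] [NormedSpace ℝ G] (x y : EuclideanSpace ℝ ι)
    (A : EuclideanSpace ℝ ι →L[ℝ] EuclideanSpace ℝ ι →L[ℝ] G) :
    ∑ k, ∑ l, (x k * y l) • A (EuclideanSpace.single k 1) (EuclideanSpace.single l 1) =
      A x y := by
  have hsum : ∀ z : EuclideanSpace ℝ ι, ∑ k, z k • EuclideanSpace.single k (1 : ℝ) = z :=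
    fun z => by simpa using (EuclideanSpace.basisFun ι ℝ).sum_repr z
  conv_rhs => rw [← hsum x, ← hsum y]
  simp only [map_sum, map_smul, sum_apply, smul_apply, mul_smul, Finset.smul_sum]
  rw [Finset.sum_comm]
  simp only [smul_comm (x _) (y _)]

theorem sewGerm_add_sub_eq {ℓ n : ℕ}
    {X : ℝ → ℝ → EuclideanSpace ℝ (Fin ℓ)} {XX : ℝ → ℝ → EuclideanSpace ℝ (Fin ℓ × Fin ℓ)}
    (F : ℝ → EuclideanSpace ℝ (Fin ℓ) →L[ℝ] EuclideanSpace ℝ (Fin n))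
    (F' : ℝ → EuclideanSpace ℝ (Fin ℓ) →L[ℝ]
      (EuclideanSpace ℝ (Fin ℓ) →L[ℝ] EuclideanSpace ℝ (Fin n)))
    {s u t : ℝ} (hX : X t s = X t u + X u s)
    (hXX : ∀ q : Fin ℓ × Fin ℓ, XX t s q = XX t u q + XX u s q + X u s q.1 * X t u q.2) :
    sewGerm F F' X XX t u + sewGerm F F' X XX u s - sewGerm F F' X XX t s =
      (F u - F s - F' s (X u s)) (X t u) +
        ∑ k, ∑ l, XX t u (k, l) •
          (F' u - F' s) (EuclideanSpace.single k 1) (EuclideanSpace.single l 1) := by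
  unfold sewGerm
  simp only [hX, hXX, add_smul, Finset.sum_add_distrib, sum_mul_smul_apply_single,
    sub_apply, smul_sub, Finset.sum_sub_distrib, map_add]
  abel

theorem norm_sewGerm_add_sub_le {ℓ n : ℕ} {T p : ℝ} (hp : 0 < p)
    {X : ℝ → ℝ → EuclideanSpace ℝ (Fin ℓ)} {XX : ℝ → ℝ → EuclideanSpace ℝ (Fin ℓ × Fin ℓ)}
    (hChen : ∀ s u t : ℝ, 0 ≤ s → s ≤ u → u ≤ t → t ≤ T →
      X t s = X t u + X u s ∧
      ∀ q : Fin ℓ × Fin ℓ, XX t s q = XX t u q + XX u s q + X u s q.1 * X t u q.2)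
    {CX : ℝ}
    (hX : ∀ s t : ℝ, 0 ≤ s → s ≤ t → t ≤ T →
      ‖X t s‖ ≤ CX * (t - s) ^ (1 / p) ∧ ‖XX t s‖ ≤ CX * (t - s) ^ (2 / p))
    {F : ℝ → EuclideanSpace ℝ (Fin ℓ) →L[ℝ] EuclideanSpace ℝ (Fin n)}
    {F' : ℝ → EuclideanSpace ℝ (Fin ℓ) →L[ℝ]
      (EuclideanSpace ℝ (Fin ℓ) →L[ℝ] EuclideanSpace ℝ (Fin n))}
    {C1 C2 : ℝ}
    (hF' : ∀ s t : ℝ, 0 ≤ s → s ≤ t → t ≤ T → ‖F' t - F' s‖ ≤ C1 * (t - s) ^ (1 / p))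
    (hF : ∀ s t : ℝ, 0 ≤ s → s ≤ t → t ≤ T →
      ‖F t - F s - F' s (X t s)‖ ≤ C2 * (t - s) ^ (2 / p))
    {s u t : ℝ} (hs : 0 ≤ s) (hsu : s ≤ u) (hut : u ≤ t) (ht : t ≤ T) :
    ‖sewGerm F F' X XX t u + sewGerm F F' X XX u s - sewGerm F F' X XX t s‖ ≤
      (|C2| * |CX| + (ℓ : ℝ) ^ 2 * (|CX| * |C1|)) * (t - s) ^ (3 / p) := by
  have hst : 0 ≤ t - s := by linarith
  have mono : ∀ {x C v w e : ℝ}, x ≤ C * (w - v) ^ e → s ≤ v → v ≤ w → w ≤ t → 0 ≤ e →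
      x ≤ |C| * (t - s) ^ e := by
    intro x C v w e hx h1 h2 h3 he
    have hvw : 0 ≤ w - v := by linarith
    have hpow : (w - v) ^ e ≤ (t - s) ^ e := Real.rpow_le_rpow hvw (by linarith) he
    exact hx.trans (mul_le_mul (le_abs_self C) hpow (by positivity) (abs_nonneg C))
  have hu0 := hs.trans hsu
  have e1 : 0 ≤ 1 / p := by positivity
  have e2 : 0 ≤ 2 / p := by positivity
  have hb1 := mono (hX u t hu0 hut ht).1 hsu hut le_rfl e1
  have hb2 := mono (hX u t hu0 hut ht).2 hsu hut le_rfl e2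
  have hb3 := mono (hF' s u hs hsu (hut.trans ht)) le_rfl hsu hut e1
  have hb4 := mono (hF s u hs hsu (hut.trans ht)) le_rfl hsu hut e2
  have hpow : (t - s) ^ (3 / p) = (t - s) ^ (2 / p) * (t - s) ^ (1 / p) := by
    rw [← Real.rpow_add_of_nonneg hst e2 e1]
    ring_nf
  obtain ⟨hc1, hc2⟩ := hChen s u t hs hsu hut ht
  rw [sewGerm_add_sub_eq F F' hc1 hc2]
  calc _ ≤ ‖F u - F s - F' s (X u s)‖ * ‖X t u‖ + (ℓ : ℝ) ^ 2 * (‖XX t u‖ * ‖F' u - F' s‖) := by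
        refine norm_add_le_of_le (ContinuousLinearMap.le_opNorm _ _) ?_
        simpa using norm_sum_smul_apply_single_le (XX t u) (F' u - F' s)
    _ ≤ |C2| * (t - s) ^ (2 / p) * (|CX| * (t - s) ^ (1 / p)) +
        (ℓ : ℝ) ^ 2 * (|CX| * (t - s) ^ (2 / p) * (|C1| * (t - s) ^ (1 / p))) := by gcongr
    _ = _ := by rw [hpow]; ring

/-- **Rough integral.**  For `2 < p < 3`, a Hölder `p`-rough path `(X, 𝕏)` over `ℝ^ℓ` and
a controlled path `(F, F')` with values in `L(ℝ^ℓ, ℝ^n)`, the germ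
`μ_{ts} = F_s X_{ts} + F'_s 𝕏_{ts}` is almost additive with exponent `3/p`, and there is
a unique path `I` with `I 0 = 0` and `|I_t - I_s - μ_{ts}| ≤ c' |t-s|^{3/p}`: the rough
integral `∫ F dX`. -/
theorem rough_integral
    (ℓ n : ℕ) (T p : ℝ) (hT : 0 < T) (hp1 : 2 < p) (hp2 : p < 3)
    (X : ℝ → ℝ → EuclideanSpace ℝ (Fin ℓ))
    (XX : ℝ → ℝ → EuclideanSpace ℝ (Fin ℓ × Fin ℓ))
    (hXcont : ContinuousOn (fun q : ℝ × ℝ => X q.2 q.1)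
      {q : ℝ × ℝ | 0 ≤ q.1 ∧ q.1 ≤ q.2 ∧ q.2 ≤ T})
    (hXXcont : ContinuousOn (fun q : ℝ × ℝ => XX q.2 q.1)
      {q : ℝ × ℝ | 0 ≤ q.1 ∧ q.1 ≤ q.2 ∧ q.2 ≤ T})
    (hChen : ∀ s u t : ℝ, 0 ≤ s → s ≤ u → u ≤ t → t ≤ T →
      X t s = X t u + X u s ∧
      ∀ q : Fin ℓ × Fin ℓ, XX t s q = XX t u q + XX u s q + X u s q.1 * X t u q.2)
    (CX : ℝ)
    (hX : ∀ s t : ℝ, 0 ≤ s → s ≤ t → t ≤ T →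
      ‖X t s‖ ≤ CX * (t - s) ^ (1 / p) ∧ ‖XX t s‖ ≤ CX * (t - s) ^ (2 / p))
    (F : ℝ → EuclideanSpace ℝ (Fin ℓ) →L[ℝ] EuclideanSpace ℝ (Fin n))
    (F' : ℝ → EuclideanSpace ℝ (Fin ℓ) →L[ℝ]
      (EuclideanSpace ℝ (Fin ℓ) →L[ℝ] EuclideanSpace ℝ (Fin n)))
    (C1 C2 : ℝ)
    (hF' : ∀ s t : ℝ, 0 ≤ s → s ≤ t → t ≤ T → ‖F' t - F' s‖ ≤ C1 * (t - s) ^ (1 / p))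
    (hF : ∀ s t : ℝ, 0 ≤ s → s ≤ t → t ≤ T →
      ‖F t - F s - F' s (X t s)‖ ≤ C2 * (t - s) ^ (2 / p)) :
    (∃ c > (0:ℝ), ∀ s u t : ℝ, 0 ≤ s → s ≤ u → u ≤ t → t ≤ T →
      ‖sewGerm F F' X XX t u + sewGerm F F' X XX u s - sewGerm F F' X XX t s‖ ≤
        c * (t - s) ^ (3 / p)) ∧
    ∃ I : ℝ → EuclideanSpace ℝ (Fin n),
      (I 0 = 0 ∧ ∃ c' > (0:ℝ), ∀ s t : ℝ, 0 ≤ s → s ≤ t → t ≤ T →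
        ‖I t - I s - sewGerm F F' X XX t s‖ ≤ c' * (t - s) ^ (3 / p)) ∧
      ∀ J : ℝ → EuclideanSpace ℝ (Fin n),
        (J 0 = 0 ∧ ∃ c' > (0:ℝ), ∀ s t : ℝ, 0 ≤ s → s ≤ t → t ≤ T →
          ‖J t - J s - sewGerm F F' X XX t s‖ ≤ c' * (t - s) ^ (3 / p)) →
        ∀ t : ℝ, 0 ≤ t → t ≤ T → J t = I t := by
  have hp : 0 < p := by linarith
  have ha : 1 < 3 / p := by rwa [lt_div_iff₀ hp, one_mul]
  set c := |C2| * |CX| + (ℓ : ℝ) ^ 2 * (|CX| * |C1|)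
  have hc : 0 ≤ c := by positivity
  have hμ : ∀ s u t : ℝ, 0 ≤ s → s ≤ u → u ≤ t → t ≤ T →
      ‖sewGerm F F' X XX t u + sewGerm F F' X XX u s - sewGerm F F' X XX t s‖ ≤
        c * (t - s) ^ (3 / p) :=
    fun s u t hs hsu hut ht => norm_sewGerm_add_sub_le hp hChen hX hF' hF hs hsu hut ht
  refine ⟨⟨c + 1, by linarith, fun s u t hs hsu hut ht => (hμ s u t hs hsu hut ht).trans ?_⟩, ?_⟩
  · have : 0 ≤ t - s := by linarith
    gcongr
    linarith
  obtain ⟨I, hI0, c₁, hI⟩ := exists_sewing_s12 ha hc hμ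
  refine ⟨I, ⟨hI0, max c₁ 1, by positivity, fun s t hs hst ht => (hI s t hs hst ht).trans ?_⟩, ?_⟩
  · have : 0 ≤ t - s := by linarith
    gcongr
    exact le_max_left _ _
  rintro J ⟨hJ0, c₂, -, hJ⟩ t ht0 htT
  have hD : ∀ s t : ℝ, 0 ≤ s → s ≤ t → t ≤ T →
      ‖(J - I) t - (J - I) s‖ ≤ (c₂ + c₁) * (t - s) ^ (3 / p) := by
    intro s t hs hst ht
    calc ‖(J - I) t - (J - I) s‖ = ‖(J t - J s - sewGerm F F' X XX t s) -
          (I t - I s - sewGerm F F' X XX t s)‖ := by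
          simp only [Pi.sub_apply]
          congr 1
          abel
      _ ≤ c₂ * (t - s) ^ (3 / p) + c₁ * (t - s) ^ (3 / p) :=
          norm_sub_le_of_le (hJ s t hs hst ht) (hI s t hs hst ht)
      _ = _ := by ring
  have h := eq_of_norm_sub_le_rpow_s12 ha hD ht0 htT
  rw [Pi.sub_apply, Pi.sub_apply, hJ0, hI0, sub_zero] at h
  exact sub_eq_zero.1 h
end
end
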